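/- Let G be an upper semicontinuous decomposition of ℝ² into compact convex sets, with quotient map π : ℝ² → ℝ²/G, and let d be any metric on ℝ²/G inducing the quotient topology. Then π is a near-homeomorphism in the following sense: for every compact set K ⊆ ℝ² and every ε > 0 there exists a homeomorphism h : ℝ² → ℝ²/G such that d(h(x), π(x)) < ε for all x ∈ K. -/

import Mathlib

namespace MoorePlane

open Set Filter Topology Metric

theorem exists_vertical_homeomorph (Φ : ℝ × ℝ → ℝ) (hc : Continuous Φ)
    (hm : ∀ x, StrictMono fun y => Φ (x, y))
    (hs : ∀ x, Function.Surjective fun y => Φ (x, y)) :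
    ∃ h : ℝ × ℝ ≃ₜ ℝ × ℝ, ∀ p, h p = (p.1, Φ p) := by
  choose Ψ hΨ using hs
  have key : ∀ x y, Ψ x (Φ (x, y)) = y := fun x y => (hm x).injective (hΨ x _)
  have hcont : Continuous fun p : ℝ × ℝ => Ψ p.1 p.2 := by
    rw [continuous_iff_continuousAt]
    rintro ⟨x, z⟩
    refine tendsto_order.2 ⟨fun c hc' => ?_, fun c hc' => ?_⟩
    · have h1 : Φ (x, c) < z := by
        have := hm x hc'
        simpa [hΨ] using this
      have h2 : ∀ᶠ p : ℝ × ℝ in 𝓝 (x, z), Φ (p.1, c) < p.2 :=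
        (isOpen_lt (by fun_prop) (by fun_prop)).mem_nhds h1
      filter_upwards [h2] with p hp
      refine (hm p.1).lt_iff_lt.1 ?_
      simpa [hΨ] using hp
    · have h1 : z < Φ (x, c) := by
        have := hm x hc'
        simpa [hΨ] using this
      have h2 : ∀ᶠ p : ℝ × ℝ in 𝓝 (x, z), p.2 < Φ (p.1, c) :=
        (isOpen_lt (by fun_prop) (by fun_prop)).mem_nhds h1
      filter_upwards [h2] with p hp
      refine (hm p.1).lt_iff_lt.1 ?_
      simpa [hΨ] using hp
  exact ⟨{ toFun := fun p => (p.1, Φ p)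
           invFun := fun p => (p.1, Ψ p.1 p.2)
           left_inv := fun p => by simp [key]
           right_inv := fun p => by simp [hΨ]
           continuous_toFun := by fun_prop
           continuous_invFun := by fun_prop }, fun p => rfl⟩

theorem surjective_of_bounded_displacement (f : ℝ → ℝ) (hf : Continuous f) (C : ℝ)
    (h : ∀ y, |f y - y| ≤ C) : Function.Surjective f := by
  intro z
  have hC := h z
  have h1 := abs_le.1 (h (z - C))
  have h2 := abs_le.1 (h (z + C))
  have hC0 : 0 ≤ C := (abs_nonneg _).trans hC
  have := intermediate_value_Icc (show z - C ≤ z + C by linarith) hf.continuousOn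
  obtain ⟨t, -, ht⟩ := this (show z ∈ Icc _ _ from ⟨by linarith, by linarith⟩)
  exact ⟨t, ht⟩

section Nachbin

variable {X : Type*} [TopologicalSpace X]

/-- Interpolation of a closed lower set `C` and an open lower set `W`. -/
theorem exists_lower_interpolation [CompactSpace X] [T2Space X] (R : X → X → Prop)
    (hrefl : ∀ a, R a a) (htrans : ∀ a b c, R a b → R b c → R a c)
    (hcl : IsClosed {p : X × X | R p.1 p.2}) (C W : Set X) (hC : IsClosed C)
    (hCl : ∀ a b, R a b → b ∈ C → a ∈ C) (hW : IsOpen W)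
    (hCW : C ⊆ W) :
    ∃ U C' : Set X, IsOpen U ∧ IsClosed C' ∧ (∀ a b, R a b → b ∈ U → a ∈ U) ∧
      (∀ a b, R a b → b ∈ C' → a ∈ C') ∧ C ⊆ U ∧ U ⊆ C' ∧ C' ⊆ W := by
  have hdis : Wᶜ ×ˢ C ⊆ {p : X × X | R p.1 p.2}ᶜ := by
    rintro ⟨a, b⟩ ⟨ha, hb⟩ hR
    exact ha (hCW (hCl a b hR hb))
  obtain ⟨M, N, hM, hN, hWM, hCN, hMN⟩ :=
    generalized_tube_lemma (s := Wᶜ) (t := C) (n := {p : X × X | R p.1 p.2}ᶜ)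
    hW.isClosed_compl.isCompact hC.isCompact hcl.isOpen_compl hdis
  obtain ⟨O, hO, hCO, hON⟩ : ∃ O, IsOpen O ∧ C ⊆ O ∧ closure O ⊆ N :=
    normal_exists_closure_subset hC hN hCN
  have hdown : ∀ K : Set X, IsClosed K → IsClosed {a | ∃ b ∈ K, R a b} := by
    intro K hK
    have h1 : IsCompact ({p : X × X | R p.1 p.2} ∩ Prod.snd ⁻¹' K) :=
      (hcl.inter (hK.preimage continuous_snd)).isCompact
    have h2 := (h1.image continuous_fst).isClosed
    convert h2 using 1
    ext a
    constructor
    · rintro ⟨b, hb, hab⟩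
      exact ⟨(a, b), ⟨hab, hb⟩, rfl⟩
    · rintro ⟨⟨a', b⟩, ⟨hab, hb⟩, rfl⟩
      exact ⟨b, hb, hab⟩
  have hup : ∀ K : Set X, IsClosed K → IsClosed {b | ∃ a ∈ K, R a b} := by
    intro K hK
    have h1 : IsCompact ({p : X × X | R p.1 p.2} ∩ Prod.fst ⁻¹' K) :=
      (hcl.inter (hK.preimage continuous_fst)).isCompact
    have h2 := (h1.image continuous_snd).isClosed
    convert h2 using 1
    ext a
    constructor
    · rintro ⟨b, hb, hab⟩
      exact ⟨(b, a), ⟨hab, hb⟩, rfl⟩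
    · rintro ⟨⟨b, a'⟩, ⟨hab, hb⟩, rfl⟩
      exact ⟨b, hb, hab⟩
  refine ⟨{b | ∃ a ∈ Oᶜ, R a b}ᶜ, {a | ∃ b ∈ closure O, R a b},
    (hup _ hO.isClosed_compl).isOpen_compl, hdown _ isClosed_closure, ?_, ?_, ?_, ?_, ?_⟩
  · rintro a b hab hb ⟨c, hc, hca⟩
    exact hb ⟨c, hc, htrans _ _ _ hca hab⟩
  · rintro a b hab ⟨c, hc, hbc⟩
    exact ⟨c, hc, htrans _ _ _ hab hbc⟩
  · rintro a ha ⟨c, hc, hca⟩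
    exact hc (hCO (hCl _ _ hca ha))
  · intro a ha
    refine ⟨a, ?_, hrefl a⟩
    by_contra h
    exact ha ⟨a, fun h' => h (subset_closure h'), hrefl a⟩
  · rintro a ⟨b, hb, hab⟩
    by_contra h
    exact hMN (show (a, b) ∈ M ×ˢ N from ⟨hWM h, hON hb⟩) hab

theorem exists_monotone_separating [CompactSpace X] [T2Space X] (R : X → X → Prop)
    (hrefl : ∀ a, R a a) (htrans : ∀ a b c, R a b → R b c → R a c)
    (hcl : IsClosed {p : X × X | R p.1 p.2}) (p q : X) (hpq : ¬ R q p) :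
    ∃ f : X → ℝ, Continuous f ∧ (∀ a b, R a b → f a ≤ f b) ∧ f p = 0 ∧ f q = 1 ∧
      ∀ a, f a ∈ Icc (0 : ℝ) 1 := by
  let P : Set X → Set X → Prop := fun c u =>
    (∀ a b, R a b → b ∈ u → a ∈ u) ∧
      ∃ C : Set X, IsClosed C ∧ (∀ a b, R a b → b ∈ C → a ∈ C) ∧ c ⊆ C ∧ C ⊆ u
  have hClp : IsClosed {a | R a p} := hcl.preimage (f := fun a => (a, p)) (by fun_prop)
  have hClq : IsClosed {a | R q a} := hcl.preimage (f := fun a => (q, a)) (by fun_prop)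
  let c : Urysohns.CU P :=
    { C := {a | R a p}
      U := {a | R q a}ᶜ
      P_C_U := by
        refine ⟨fun a b hab hb ha => hb (htrans _ _ _ ha hab), {a | R a p}, hClp,
          fun a b hab hb => htrans _ _ _ hab hb, Subset.rfl, ?_⟩
        intro a ha ha'
        exact hpq (htrans _ _ _ ha' ha)
      closed_C := hClp
      open_U := hClq.isOpen_compl
      subset := by
        intro a ha ha'
        exact hpq (htrans _ _ _ ha' ha)
      hP := by
        rintro c u - ⟨hul, C, hC, hCl, hcC, hCu⟩ hu -
        obtain ⟨U, C', hU, hC', hUl, hCl', h1, h2, h3⟩ :=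
          exists_lower_interpolation R hrefl htrans hcl C u hC hCl hu hCu
        have h4 : closure U ⊆ C' := closure_minimal h2 hC'
        exact ⟨U, hU, hcC.trans h1, h4.trans h3, ⟨hUl, C, hC, hCl, hcC, h1⟩,
          ⟨hul, C', hC', hCl', h4, h3⟩⟩ }
  have happ : ∀ n : ℕ, ∀ d : Urysohns.CU P, ∀ a b, R a b →
      d.approx n a ≤ d.approx n b := by
    intro n
    induction n with
    | zero =>
      intro d a b hab
      have hl := d.P_C_U.1
      simp only [Urysohns.CU.approx]
      by_cases hb : b ∈ d.U
      · have ha := hl a b hab hb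
        simp [ha, hb]
      · by_cases ha : a ∈ d.U <;> simp [ha, hb]
    | succ n ih =>
      intro d a b hab
      simp only [Urysohns.CU.approx]
      rw [midpoint_eq_smul_add, midpoint_eq_smul_add]
      have h1 := ih d.left a b hab
      have h2 := ih d.right a b hab
      exact smul_le_smul_of_nonneg_left (add_le_add h1 h2) (by norm_num)
  refine ⟨c.lim, c.continuous_lim, fun a b hab => ?_, ?_, ?_, c.lim_mem_Icc⟩
  · exact le_of_tendsto_of_tendsto' (c.tendsto_approx_atTop a) (c.tendsto_approx_atTop b)
      fun n => happ n c a b hab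
  · exact c.lim_of_mem_C _ (hrefl p)
  · exact c.lim_of_notMem_U _ (fun h => h (hrefl q))

/-- Nachbin's theorem for closed preorders on compact second countable spaces. -/
theorem exists_strictly_monotone_of_closed_preorder [CompactSpace X] [T2Space X]
    [SecondCountableTopology X] (R : X → X → Prop)
    (hrefl : ∀ a, R a a) (htrans : ∀ a b c, R a b → R b c → R a c)
    (hcl : IsClosed {p : X × X | R p.1 p.2}) :
    ∃ f : X → ℝ, Continuous f ∧ (∀ a b, R a b → f a ≤ f b) ∧
      ∀ a b, R a b → ¬ R b a → f a < f b := by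
  have hsep : ∀ z : {z : X × X // ¬ R z.2 z.1}, ∃ f : X → ℝ, Continuous f ∧
      (∀ a b, R a b → f a ≤ f b) ∧ f z.1.1 = 0 ∧ f z.1.2 = 1 ∧ ∀ a, f a ∈ Icc (0 : ℝ) 1 :=
    fun z => exists_monotone_separating R hrefl htrans hcl z.1.1 z.1.2 z.2
  choose g hgc hgm hg0 hg1 hgI using hsep
  obtain ⟨T, hT, hTu⟩ := TopologicalSpace.isOpen_iUnion_countable
    (fun z : {z : X × X // ¬ R z.2 z.1} => {w : X × X | g z w.1 < g z w.2})
    (fun z => isOpen_lt ((hgc z).comp continuous_fst) ((hgc z).comp continuous_snd))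
  rcases T.eq_empty_or_nonempty with hTe | hTne
  · refine ⟨fun _ => 0, continuous_const, fun _ _ _ => le_rfl, fun a b hab hba => ?_⟩
    have : (a, b) ∈ ⋃ z : {z : X × X // ¬ R z.2 z.1}, {w : X × X | g z w.1 < g z w.2} :=
      mem_iUnion.2 ⟨⟨(a, b), hba⟩, by simp [hg0 ⟨(a, b), hba⟩, hg1 ⟨(a, b), hba⟩]⟩
    rw [← hTu, hTe] at this
    simp at this
  obtain ⟨e, he⟩ := hT.exists_eq_range hTne
  have hsum : ∀ a, Summable fun n : ℕ => (1 / 2 : ℝ) ^ n * g (e n) a := fun a =>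
    Summable.of_nonneg_of_le (fun n => mul_nonneg (by positivity) (hgI _ _).1)
      (fun n => mul_le_of_le_one_right (by positivity) (hgI _ _).2) summable_geometric_two
  refine ⟨fun a => ∑' n : ℕ, (1 / 2 : ℝ) ^ n * g (e n) a, ?_, ?_, ?_⟩
  · refine continuous_tsum (fun n => continuous_const.mul (hgc _)) summable_geometric_two ?_
    intro n x
    rw [Real.norm_of_nonneg (mul_nonneg (by positivity) (hgI _ _).1)]
    exact mul_le_of_le_one_right (by positivity) (hgI _ _).2
  · intro a b hab
    exact (hsum a).tsum_le_tsum
      (fun n => mul_le_mul_of_nonneg_left (hgm _ _ _ hab) (by positivity)) (hsum b)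
  · intro a b hab hba
    have : (a, b) ∈ ⋃ z : {z : X × X // ¬ R z.2 z.1}, {w : X × X | g z w.1 < g z w.2} :=
      mem_iUnion.2 ⟨⟨(a, b), hba⟩, by simp [hg0 ⟨(a, b), hba⟩, hg1 ⟨(a, b), hba⟩]⟩
    rw [← hTu, he] at this
    simp only [mem_range, iUnion_exists, iUnion_iUnion_eq', mem_iUnion, mem_ofPred_eq] at this
    obtain ⟨n, hn⟩ := this
    exact (hsum a).tsum_lt_tsum
      (fun n => mul_le_mul_of_nonneg_left (hgm _ _ _ hab) (by positivity))
      (mul_lt_mul_of_pos_left hn (by positivity)) (hsum b)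

end Nachbin

section Box

/-- Clamping to the interval `[-M, M]`. -/
def clamp (M y : ℝ) : ℝ := max (-M) (min y M)

theorem continuous_clamp (M : ℝ) : Continuous (clamp M) := by
  unfold clamp; fun_prop

theorem clamp_monotone (M : ℝ) : Monotone (clamp M) := fun a b h => by
  unfold clamp; gcongr

theorem clamp_mem {M : ℝ} (hM : 0 ≤ M) (y : ℝ) : |clamp M y| ≤ M := by
  unfold clamp
  rw [abs_le]
  exact ⟨le_max_left _ _, max_le (by linarith) (min_le_right _ _)⟩

theorem clamp_of_mem {M y : ℝ} (hy : |y| ≤ M) : clamp M y = y := by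
  have := abs_le.1 hy
  unfold clamp
  rw [min_eq_left this.2, max_eq_right this.1]

theorem clamp_of_ge {M y : ℝ} (hM : 0 ≤ M) (hy : M ≤ y) : clamp M y = M := by
  unfold clamp
  rw [min_eq_right hy, max_eq_right (by linarith)]

theorem clamp_of_le {M y : ℝ} (hM : 0 ≤ M) (hy : y ≤ -M) : clamp M y = -M := by
  unfold clamp
  rw [min_eq_left (by linarith), max_eq_left hy]

theorem sub_clamp_monotone {M : ℝ} : Monotone fun y => y - clamp M y := fun a b h => by
  simp only [clamp]
  rcases le_total a M with h1 | h1 <;> rcases le_total b M with h2 | h2 <;>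
  rcases le_total (-M) a with h3 | h3 <;> rcases le_total (-M) b with h4 | h4 <;>
  rcases le_total (-M) M with h5 | h5 <;>
  simp [*] <;> linarith

theorem abs_le_of_sub_clamp_eq {M : ℝ} (hM : 0 ≤ M) {a b : ℝ} (h : a < b)
    (he : a - clamp M a = b - clamp M b) : |a| ≤ M ∧ |b| ≤ M := by
  rw [abs_le, abs_le]
  have ha := abs_le.1 (clamp_mem hM a)
  have hb := abs_le.1 (clamp_mem hM b)
  refine ⟨⟨?_, ?_⟩, ⟨?_, ?_⟩⟩ <;> by_contra! hcon
  · have h1 := clamp_of_le hM hcon.le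
    rcases le_total b (-M) with h2 | h2
    · rw [h1, clamp_of_le hM h2] at he; linarith
    · have := clamp_of_le hM (le_refl (-M))
      have := sub_clamp_monotone (M := M) h2
      simp only at this
      linarith
  · have h1 := clamp_of_ge hM hcon.le
    rw [h1, clamp_of_ge hM (hcon.le.trans h.le)] at he; linarith
  · have h1 := clamp_of_le hM hcon.le
    rw [h1, clamp_of_le hM (h.le.trans hcon.le)] at he; linarith
  · have h1 := clamp_of_ge hM hcon.le
    rcases le_total a M with h2 | h2
    · have := clamp_of_ge hM (le_refl M)
      have := sub_clamp_monotone (M := M) h2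
      simp only at this
      linarith
    · rw [h1, clamp_of_ge hM h2] at he; linarith

theorem exists_strictly_monotone_on_box (M : ℝ) (hM : 0 < M) (R : ℝ × ℝ → ℝ × ℝ → Prop)
    (hrefl : ∀ a, R a a) (htrans : ∀ a b c, R a b → R b c → R a c)
    (hcl : IsClosed {z : (ℝ × ℝ) × (ℝ × ℝ) | ‖z‖ ≤ M ∧ R z.1 z.2}) :
    ∃ f : ℝ × ℝ → ℝ, Continuous f ∧ (∀ p, f p = f (clamp M p.1, clamp M p.2)) ∧
      (∀ p q, ‖p‖ ≤ M → ‖q‖ ≤ M → R p q → f p ≤ f q) ∧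
      ∀ p q, ‖p‖ ≤ M → ‖q‖ ≤ M → R p q → ¬ R q p → f p < f q := by
  have : CompactSpace (closedBall (0 : ℝ × ℝ) M) :=
    isCompact_iff_compactSpace.1 (isCompact_closedBall _ _)
  have hcl' : IsClosed {z : closedBall (0 : ℝ × ℝ) M × closedBall (0 : ℝ × ℝ) M |
      R z.1 z.2} := by
    have hc : Continuous fun z : closedBall (0 : ℝ × ℝ) M × closedBall (0 : ℝ × ℝ) M =>
      ((z.1 : ℝ × ℝ), (z.2 : ℝ × ℝ)) := by fun_prop
    convert hcl.preimage hc using 1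
    ext ⟨⟨a, ha⟩, ⟨b, hb⟩⟩
    rw [mem_closedBall_zero_iff] at ha hb
    simp only [mem_ofPred_eq, mem_preimage]
    exact ⟨fun h => ⟨(Prod.norm_def ((a, b) : (ℝ × ℝ) × (ℝ × ℝ))) ▸ max_le ha hb, h⟩,
      fun h => h.2⟩
  obtain ⟨f, hf, hfm, hfs⟩ := exists_strictly_monotone_of_closed_preorder
    (fun a b : closedBall (0 : ℝ × ℝ) M => R a b) (fun a => hrefl a)
    (fun a b c => htrans a b c) hcl'
  have hmem : ∀ p : ℝ × ℝ, (clamp M p.1, clamp M p.2) ∈ closedBall (0 : ℝ × ℝ) M := by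
    intro p
    rw [mem_closedBall_zero_iff, Prod.norm_def]
    exact max_le (clamp_mem hM.le _) (clamp_mem hM.le _)
  have hid : ∀ p : ℝ × ℝ, ‖p‖ ≤ M → (clamp M p.1, clamp M p.2) = p := by
    intro p hp
    rw [Prod.norm_def] at hp
    rw [clamp_of_mem ((le_max_left _ _).trans hp), clamp_of_mem ((le_max_right _ _).trans hp)]
  have hid' : ∀ (p : ℝ × ℝ) (hp : ‖p‖ ≤ M), (⟨_, hmem p⟩ : closedBall (0 : ℝ × ℝ) M) =
      ⟨p, mem_closedBall_zero_iff.2 hp⟩ := fun p hp => Subtype.ext (hid p hp)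
  refine ⟨fun p => f ⟨_, hmem p⟩, ?_, ?_, ?_, ?_⟩
  · refine hf.comp (Continuous.subtype_mk ?_ _)
    exact ((continuous_clamp M).comp continuous_fst).prodMk
      ((continuous_clamp M).comp continuous_snd)
  · intro p
    refine congrArg f (Subtype.ext ?_)
    simp only
    rw [clamp_of_mem (clamp_mem hM.le _), clamp_of_mem (clamp_mem hM.le _)]
  · intro p q hp hq h
    simp only [hid' p hp, hid' q hq]
    exact hfm _ _ h
  · intro p q hp hq h h'
    simp only [hid' p hp, hid' q hq]
    exact hfs _ _ h h'

end Box

theorem isClosed_or {X : Type*} [TopologicalSpace X] {p q : X → Prop}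
    (hp : IsClosed {x | p x}) (hq : IsClosed {x | q x}) : IsClosed {x | p x ∨ q x} :=
  hp.union hq

theorem exists_vertical_collapse {Q : Type*} [TopologicalSpace Q] [T2Space Q] (π : ℝ × ℝ → Q)
    (hπ : Continuous π) (A : Set Q) (hA : IsClosed A) (M : ℝ) (hM : 1 < M)
    (hbox : ∀ p, π p ∈ A → |p.1| ≤ M - 1 ∧ |p.2| ≤ M - 1)
    (hconv : ∀ q ∈ A, ∀ x, OrdConnected {y | π (x, y) = q}) :
    ∃ W : ℝ × ℝ → ℝ, Continuous W ∧ (∀ x, Monotone fun y => W (x, y)) ∧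
      (∀ p, M ≤ |p.1| ∨ M ≤ |p.2| → W p = p.2) ∧
      ∀ x y y', W (x, y) = W (x, y') ↔ (y = y' ∨ (π (x, y) = π (x, y') ∧ π (x, y) ∈ A)) := by
  have hM0 : 0 < M := by linarith
  let R : ℝ × ℝ → ℝ × ℝ → Prop := fun p q => p.1 = q.1 ∧ (p.2 ≤ q.2 ∨ (π p = π q ∧ π p ∈ A))
  have hord : ∀ {x a b c}, π (x, a) = π (x, c) → π (x, a) ∈ A → a ≤ b → b ≤ c →
      π (x, b) = π (x, a) := by
    intro x a b c h1 h2 h3 h4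
    exact (hconv _ h2 x).out (show π (x, a) = _ from rfl) h1.symm ⟨h3, h4⟩
  obtain ⟨f, hf, hfc, hfm, hfs⟩ := exists_strictly_monotone_on_box M hM0 R
    (fun a => ⟨rfl, Or.inl le_rfl⟩)
    (by
      rintro ⟨x, a⟩ ⟨x', b⟩ ⟨x'', c⟩ ⟨h1, h2⟩ ⟨h3, h4⟩
      dsimp only at h1 h2 h3 h4
      subst h1 h3
      refine ⟨rfl, ?_⟩
      dsimp only
      rcases le_or_gt a c with h | h
      · exact Or.inl h
      refine Or.inr ?_
      rcases h2 with h2 | h2 <;> rcases h4 with h4 | h4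
      · linarith
      · have := hord h4.1.symm (h4.1 ▸ h4.2) h.le h2
        rw [this]
        exact ⟨rfl, h4.1 ▸ h4.2⟩
      · have := hord h2.1.symm (h2.1 ▸ h2.2) h4 h.le
        rw [this]
        exact ⟨h2.1, h2.2⟩
      · exact ⟨h2.1.trans h4.1, h2.2⟩)
    (by
      refine IsClosed.and (isClosed_le (by fun_prop) (by fun_prop)) (IsClosed.and
        (isClosed_eq (by fun_prop) (by fun_prop)) (isClosed_or
        (isClosed_le (by fun_prop) (by fun_prop)) (IsClosed.and
        (isClosed_eq (by fun_prop) (by fun_prop))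
        (hA.preimage (f := fun z : (ℝ × ℝ) × (ℝ × ℝ) => π z.1) (by fun_prop))))))
  have hn : ∀ {x y : ℝ}, |x| ≤ M → |y| ≤ M → ‖((x, y) : ℝ × ℝ)‖ ≤ M := by
    intro x y hx hy
    exact max_le hx hy
  have hfmono : ∀ x, Monotone fun y => f (x, y) := by
    intro x a b hab
    simp only
    rw [hfc (x, a), hfc (x, b)]
    exact hfm _ _ (hn (clamp_mem hM0.le _) (clamp_mem hM0.le _))
      (hn (clamp_mem hM0.le _) (clamp_mem hM0.le _)) ⟨rfl, Or.inl (clamp_monotone M hab)⟩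
  have hMM : clamp M M = M := clamp_of_ge hM0.le le_rfl
  have hMM' : clamp M (-M) = -M := clamp_of_le hM0.le le_rfl
  have habs : |M| = M := abs_of_pos hM0
  have hfpos : ∀ x, 0 < f (x, M) - f (x, -M) := by
    intro x
    rw [hfc (x, M), hfc (x, -M), sub_pos]
    refine hfs _ _ (hn (clamp_mem hM0.le _) (clamp_mem hM0.le _))
      (hn (clamp_mem hM0.le _) (clamp_mem hM0.le _)) ⟨rfl, Or.inl ?_⟩ ?_
    · exact clamp_monotone M (by linarith)
    · rintro ⟨-, h | ⟨-, h⟩⟩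
      · simp only [hMM, hMM'] at h
        linarith
      · have := (hbox _ h).2
        simp only [hMM, habs] at this
        linarith
  let W1 : ℝ × ℝ → ℝ := fun p =>
    -M + 2 * M * ((f p - f (p.1, -M)) / (f (p.1, M) - f (p.1, -M))) + (p.2 - clamp M p.2)
  have hW1c : Continuous W1 := by
    have := continuous_clamp M
    have h0 : ∀ p : ℝ × ℝ, f (p.1, M) - f (p.1, -M) ≠ 0 := fun p => (hfpos p.1).ne'
    have hd : Continuous fun p : ℝ × ℝ =>
        (f p - f (p.1, -M)) / (f (p.1, M) - f (p.1, -M)) :=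
      Continuous.div (by fun_prop) (by fun_prop) h0
    fun_prop
  have hW1m : ∀ x, Monotone fun y => W1 (x, y) := by
    intro x a b hab
    have h1 : (f (x, a) - f (x, -M)) / (f (x, M) - f (x, -M)) ≤
        (f (x, b) - f (x, -M)) / (f (x, M) - f (x, -M)) :=
      div_le_div_of_nonneg_right (sub_le_sub_right (hfmono x hab) _) (hfpos x).le
    have h2 := sub_clamp_monotone (M := M) hab
    simp only at h2
    have h3 := mul_le_mul_of_nonneg_left h1 (show 0 ≤ 2 * M by linarith)
    simp only [W1]
    linarith
  have hW1o : ∀ p : ℝ × ℝ, M ≤ |p.2| → W1 p = p.2 := by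
    rintro ⟨x, y⟩ h
    simp only [W1] at h ⊢
    rcases le_abs.1 h with h | h
    · have h1 := clamp_of_ge hM0.le h
      rw [hfc (x, y), h1]
      have : f (x, M) = f (clamp M x, M) := by rw [hfc (x, M)]; simp only [hMM]
      rw [← this, div_self (hfpos x).ne']
      ring
    · have h1 := clamp_of_le hM0.le (show y ≤ -M by linarith)
      rw [hfc (x, y), h1]
      have : f (x, -M) = f (clamp M x, -M) := by rw [hfc (x, -M)]; simp only [hMM']
      rw [← this, sub_self]
      ring
  let χ : ℝ → ℝ := fun x => max 0 (min 1 (M - |x|))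
  have hχ0 : ∀ x, 0 ≤ χ x := fun x => le_max_left _ _
  have hχ1 : ∀ x, χ x ≤ 1 := fun x => max_le zero_le_one (min_le_left _ _)
  have hχa : ∀ x, |x| ≤ M - 1 → χ x = 1 := by
    intro x hx
    simp only [χ]
    rw [min_eq_left (by linarith), max_eq_right zero_le_one]
  have hχb : ∀ x, χ x = 1 → |x| ≤ M - 1 := by
    intro x hx
    by_contra! h
    have : χ x < 1 := max_lt zero_lt_one ((min_le_right _ _).trans_lt (by linarith))
    linarith
  have hχc : ∀ x, M ≤ |x| → χ x = 0 := by
    intro x hx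
    exact max_eq_left ((min_le_right _ _).trans (by linarith))
  refine ⟨fun p => p.2 + χ p.1 * (W1 p - p.2), ?_, ?_, ?_, ?_⟩
  · have : Continuous χ := by fun_prop
    fun_prop
  · intro x a b hab
    have h1 := mul_le_mul_of_nonneg_left (hW1m x hab) (hχ0 x)
    have h2 := mul_le_mul_of_nonneg_left hab (sub_nonneg.2 (hχ1 x))
    simp only at h1 h2 ⊢
    linarith
  · rintro p (h | h)
    · simp [hχc _ h]
    · simp [hW1o p h]
  · intro x y y'
    have main : ∀ a b, a < b → (a + χ x * (W1 (x, a) - a) = b + χ x * (W1 (x, b) - b) ↔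
        (π (x, a) = π (x, b) ∧ π (x, a) ∈ A)) := by
      intro a b hab
      have m1 := mul_le_mul_of_nonneg_left (hW1m x hab.le) (hχ0 x)
      have m2 := mul_le_mul_of_nonneg_left hab.le (sub_nonneg.2 (hχ1 x))
      have f1 : (f (x, a) - f (x, -M)) / (f (x, M) - f (x, -M)) ≤
          (f (x, b) - f (x, -M)) / (f (x, M) - f (x, -M)) :=
        div_le_div_of_nonneg_right (sub_le_sub_right (hfmono x hab.le) _) (hfpos x).le
      have f2 := sub_clamp_monotone (M := M) hab.le
      have f3 := mul_le_mul_of_nonneg_left f1 (show 0 ≤ 2 * M by linarith)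
      simp only at m1 m2 f2
      constructor
      · intro h
        have h1 : (1 - χ x) * (b - a) = 0 := by nlinarith
        have h2 : χ x = 1 := by
          rcases mul_eq_zero.1 h1 with h | h <;> linarith
        have hx := hχb x h2
        rw [h2] at h
        have h3 : W1 (x, a) = W1 (x, b) := by linarith
        simp only [W1] at h3
        have h4 : a - clamp M a = b - clamp M b := by linarith
        have h5 : (f (x, a) - f (x, -M)) / (f (x, M) - f (x, -M)) =
          (f (x, b) - f (x, -M)) / (f (x, M) - f (x, -M)) := by
          have : 2 * M * ((f (x, a) - f (x, -M)) / (f (x, M) - f (x, -M))) =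
            2 * M * ((f (x, b) - f (x, -M)) / (f (x, M) - f (x, -M))) := by linarith
          exact mul_left_cancel₀ (by linarith) this
        have h6 : f (x, a) = f (x, b) := by
          have := (div_left_inj' (hfpos x).ne').1 h5
          linarith
        obtain ⟨h7, h8⟩ := abs_le_of_sub_clamp_eq hM0.le hab h4
        by_contra hcon
        have := hfs (x, a) (x, b) (hn (by linarith) h7) (hn (by linarith) h8)
          ⟨rfl, Or.inl hab.le⟩ (by
            rintro ⟨-, h | ⟨h, h'⟩⟩
            · simp only at h
              linarith
            · exact hcon ⟨h.symm, h ▸ h'⟩)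
        linarith
      · rintro ⟨h1, h2⟩
        have hx := hbox _ h2
        have hx' := hbox _ (h1 ▸ h2)
        simp only at hx hx'
        have e1 : f (x, a) = f (x, b) := by
          refine le_antisymm ?_ ?_
          · exact hfm _ _ (hn (by linarith) (by linarith)) (hn (by linarith) (by linarith))
              ⟨rfl, Or.inr ⟨h1, h2⟩⟩
          · exact hfm _ _ (hn (by linarith) (by linarith)) (hn (by linarith) (by linarith))
              ⟨rfl, Or.inr ⟨h1.symm, h1 ▸ h2⟩⟩
        simp only [W1]
        rw [hχa x hx.1, e1, clamp_of_mem (show |a| ≤ M by linarith),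
          clamp_of_mem (show |b| ≤ M by linarith)]
        ring
    rcases lt_trichotomy y y' with h | h | h
    · simp only [main y y' h]
      constructor
      · exact Or.inr
      · rintro (h' | h')
        · exact absurd h' h.ne
        · exact h'
    · subst h
      simp
    · rw [eq_comm]
      simp only [main y' y h]
      constructor
      · rintro ⟨h1, h2⟩
        exact Or.inr ⟨h1.symm, h1 ▸ h2⟩
      · rintro (h' | ⟨h1, h2⟩)
        · exact absurd h' h.ne'
        · exact ⟨h1.symm, h1 ▸ h2⟩

section Approximation

variable {M : ℝ} {W : ℝ × ℝ → ℝ}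

theorem abs_sub_le_of_eq_off_box (hM : 0 < M) (hWm : ∀ x, Monotone fun y => W (x, y))
    (hWo : ∀ p : ℝ × ℝ, M ≤ |p.1| ∨ M ≤ |p.2| → W p = p.2) (p : ℝ × ℝ) :
    |W p - p.2| ≤ 2 * M := by
  obtain ⟨x, y⟩ := p
  rcases le_or_gt M |y| with h | h
  · rw [hWo _ (Or.inr h)]; simp; linarith
  · have hy := abs_le.1 h.le
    have h1 := hWm x hy.1
    have h2 := hWm x hy.2
    simp only at h1 h2
    rw [hWo (x, M) (Or.inr (le_abs_self M))] at h2
    rw [hWo (x, -M) (Or.inr (by simp [le_abs_self]))] at h1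
    simp only at h1 h2 ⊢
    rw [abs_le]
    constructor <;> linarith

theorem exists_homeomorph_near_collapse (hM : 0 < M) (hW : Continuous W)
    (hWm : ∀ x, Monotone fun y => W (x, y))
    (hWo : ∀ p : ℝ × ℝ, M ≤ |p.1| ∨ M ≤ |p.2| → W p = p.2) (l : ℝ) (hl0 : 0 < l) (hl1 : l ≤ 1) :
    ∃ h : ℝ × ℝ ≃ₜ ℝ × ℝ, ∀ p, h p = (p.1, (1 - l) * W p + l * p.2) := by
  have hc : Continuous fun p : ℝ × ℝ => (1 - l) * W p + l * p.2 := by fun_prop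
  refine exists_vertical_homeomorph _ hc ?_ ?_
  · intro x a b hab
    have h1 := mul_le_mul_of_nonneg_left (hWm x hab.le) (sub_nonneg.2 hl1)
    have h2 := mul_lt_mul_of_pos_left hab hl0
    simp only at h1 ⊢
    linarith
  · intro x
    refine surjective_of_bounded_displacement _
      (hc.comp (Continuous.prodMk continuous_const continuous_id)) (2 * M) fun y => ?_
    have h := abs_sub_le_of_eq_off_box hM hWm hWo (x, y)
    have : (1 - l) * W (x, y) + l * y - y = (1 - l) * (W (x, y) - y) := by ring
    simp only [this, abs_mul, abs_of_nonneg (sub_nonneg.2 hl1)] at h ⊢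
    nlinarith [abs_nonneg (W (x, y) - y)]

theorem exists_homeomorph_dist_lt_collapse (hM : 0 < M) (hW : Continuous W)
    (hWm : ∀ x, Monotone fun y => W (x, y))
    (hWo : ∀ p : ℝ × ℝ, M ≤ |p.1| ∨ M ≤ |p.2| → W p = p.2) (δ : ℝ) (hδ : 0 < δ) :
    ∃ h : ℝ × ℝ ≃ₜ ℝ × ℝ, (∀ p, dist (h p) (p.1, W p) < δ) ∧
      ∀ p : ℝ × ℝ, M ≤ |p.1| ∨ M ≤ |p.2| → h p = p := by
  let l := min 1 (δ / (4 * M))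
  have hl0 : 0 < l := lt_min one_pos (by positivity)
  obtain ⟨h, hh⟩ := exists_homeomorph_near_collapse hM hW hWm hWo l hl0 (min_le_left _ _)
  refine ⟨h, fun p => ?_, fun p hp => ?_⟩
  · rw [hh, Prod.dist_eq]
    refine max_lt (by simpa using hδ) ?_
    have h1 := abs_sub_le_of_eq_off_box hM hWm hWo p
    have h2 : l * (4 * M) ≤ δ := by
      rw [← le_div_iff₀ (by positivity)]
      exact min_le_right _ _
    rw [Real.dist_eq, abs_sub_comm]
    have : W p - ((1 - l) * W p + l * p.2) = l * (W p - p.2) := by ring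
    simp only [this, abs_mul, abs_of_pos hl0]
    nlinarith
  · rw [hh, hWo p hp]
    ext
    · rfl
    · simp only; ring

theorem exists_expansion (hM : 0 < M) (hW : Continuous W)
    (hWm : ∀ x, Monotone fun y => W (x, y))
    (hWo : ∀ p : ℝ × ℝ, M ≤ |p.1| ∨ M ≤ |p.2| → W p = p.2) (κ δ : ℝ) (hκ : 0 < κ) (hδ : 0 < δ)
    (D : Set (ℝ × ℝ)) (hD : IsCompact D) (hDW : ∀ p ∈ D, ∀ t, W (p.1, t) = W p → t = p.2) :
    ∃ φ : ℝ × ℝ → ℝ, Continuous φ ∧ (∀ x, Monotone fun y => φ (x, y)) ∧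
      (∀ p : ℝ × ℝ, M ≤ |p.1| ∨ M ≤ |p.2| → φ p = p.2) ∧ (∀ p, |W (p.1, φ p) - W p| ≤ κ) ∧
      (∀ p ∈ D, |φ p - p.2| ≤ δ) ∧ ∀ x y y', W (x, y) = W (x, y') → φ (x, y) = φ (x, y') := by
  obtain ⟨m0, hm0, hm⟩ : ∃ m0 > 0, ∀ p ∈ D, W p + m0 ≤ W (p.1, p.2 + δ) ∧
      W (p.1, p.2 - δ) + m0 ≤ W p := by
    rcases D.eq_empty_or_nonempty with rfl | hne
    · exact ⟨1, one_pos, by simp⟩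
    have hc : Continuous fun p : ℝ × ℝ =>
        min (W (p.1, p.2 + δ) - W p) (W p - W (p.1, p.2 - δ)) := by fun_prop
    obtain ⟨p0, hp0, hmin⟩ := hD.exists_isMinOn hne hc.continuousOn
    refine ⟨min (W (p0.1, p0.2 + δ) - W p0) (W p0 - W (p0.1, p0.2 - δ)), ?_, fun p hp => ?_⟩
    rotate_left
    · have := le_min_iff.1 (isMinOn_iff.1 hmin p hp)
      exact ⟨by linarith [this.1], by linarith [this.2]⟩
    · refine lt_min ?_ ?_
      · refine sub_pos.2 (lt_of_le_of_ne (hWm p0.1 (by linarith)) fun h => ?_)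
        have := hDW p0 hp0 _ h.symm
        linarith
      · refine sub_pos.2 (lt_of_le_of_ne (hWm p0.1 (by linarith)) fun h => ?_)
        have := hDW p0 hp0 _ h
        linarith
  let κ' := min κ (m0 / 2)
  have hκ' : 0 < κ' := lt_min hκ (by positivity)
  let l := min 1 (κ' / (2 * M))
  have hl0 : 0 < l := lt_min one_pos (by positivity)
  have hl1 : l ≤ 1 := min_le_left _ _
  have hlκ : l * (2 * M) ≤ κ' := by
    rw [← le_div_iff₀ (by positivity)]
    exact min_le_right _ _
  obtain ⟨h, hh⟩ := exists_homeomorph_near_collapse hM hW hWm hWo l hl0 hl1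
  let φ : ℝ × ℝ → ℝ := fun p => (h.symm (p.1, W p)).2
  have hφ1 : ∀ p : ℝ × ℝ, h.symm (p.1, W p) = (p.1, φ p) := by
    intro p
    have := hh (h.symm (p.1, W p))
    rw [h.apply_symm_apply] at this
    exact Prod.ext (congrArg Prod.fst this).symm rfl
  have hφ : ∀ p : ℝ × ℝ, (1 - l) * W (p.1, φ p) + l * φ p = W p := by
    intro p
    have := hh (h.symm (p.1, W p))
    rw [h.apply_symm_apply, hφ1] at this
    exact (congrArg Prod.snd this).symm
  have hstrict : ∀ x a b, a < b → (1 - l) * W (x, a) + l * a < (1 - l) * W (x, b) + l * b := by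
    intro x a b hab
    have h1 := mul_le_mul_of_nonneg_left (hWm x hab.le) (sub_nonneg.2 hl1)
    have h2 := mul_lt_mul_of_pos_left hab hl0
    simp only at h1 ⊢
    linarith
  have hclose : ∀ p, |W (p.1, φ p) - W p| ≤ κ' := by
    intro p
    have h1 := abs_sub_le_of_eq_off_box hM hWm hWo (p.1, φ p)
    have h2 : W (p.1, φ p) - W p = l * (W (p.1, φ p) - φ p) := by rw [← hφ p]; ring
    rw [h2, abs_mul, abs_of_pos hl0]
    simp only at h1
    nlinarith
  have hmono : ∀ x, Monotone fun y => φ (x, y) := by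
    intro x a b hab
    by_contra! hcon
    have h1 := hstrict x _ _ hcon
    have ha := hφ (x, a)
    have hb := hφ (x, b)
    simp only at ha hb h1
    rw [ha, hb] at h1
    exact absurd (hWm x hab) (not_le.2 h1)
  refine ⟨φ, ?_, hmono, ?_, fun p => (hclose p).trans (min_le_left _ _), ?_, ?_⟩
  · exact continuous_snd.comp (h.symm.continuous.comp (by fun_prop))
  · intro p hp
    have : h p = (p.1, W p) := by
      rw [hh, hWo p hp]
      ext
      · rfl
      · simp only; ring
    simp only [φ, ← this, h.symm_apply_apply]
  · intro p hp
    have h1 := abs_le.1 ((hclose p).trans (min_le_right _ _))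
    have h2 := hm p hp
    rw [abs_le]
    constructor <;> by_contra! hcon
    · have := hWm p.1 (show φ p ≤ p.2 - δ by linarith)
      simp only at this
      linarith
    · have := hWm p.1 (show p.2 + δ ≤ φ p by linarith)
      simp only at this
      linarith
  · intro x y y' h
    simp only [φ, h]

end Approximation

section Straightening

variable {Q : Type*}

/-- `q` lies vertically above `p`. -/
def UpRel (p q : ℝ × ℝ) : Prop := p.1 = q.1 ∧ p.2 ≤ q.2

/-- An elementary move: upwards, or to the right along a fibre over `A`. -/
def RightStep (π : ℝ × ℝ → Q) (A : Set Q) (p q : ℝ × ℝ) : Prop :=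
  UpRel p q ∨ (π p = π q ∧ π p ∈ A ∧ p.1 ≤ q.1)

/-- The preorder generated by elementary moves upwards and to the right. -/
def RightRel (π : ℝ × ℝ → Q) (A : Set Q) : ℝ × ℝ → ℝ × ℝ → Prop :=
  Relation.ReflTransGen (RightStep π A)

/-- The reflection of the plane in the vertical axis. -/
def mirror : ℝ × ℝ ≃ₜ ℝ × ℝ := (Homeomorph.neg ℝ).prodCongr (Homeomorph.refl ℝ)

@[simp] theorem mirror_fst (p : ℝ × ℝ) : (mirror p).1 = -p.1 := rfl
@[simp] theorem mirror_snd (p : ℝ × ℝ) : (mirror p).2 = p.2 := rfl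
@[simp] theorem mirror_mirror (p : ℝ × ℝ) : mirror (mirror p) = p := by
  ext <;> simp

theorem norm_mirror (p : ℝ × ℝ) : ‖mirror p‖ = ‖p‖ := by
  simp [Prod.norm_def]

theorem RightStep.fst_le {π : ℝ × ℝ → Q} {A : Set Q} {p q : ℝ × ℝ} (h : RightStep π A p q) : p.1 ≤ q.1 := by
  rcases h with h | h
  exacts [h.1.le, h.2.2]

theorem RightRel.fst_le {π : ℝ × ℝ → Q} {A : Set Q} {p q : ℝ × ℝ} (h : RightRel π A p q) : p.1 ≤ q.1 := by
  induction h with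
  | refl => exact le_rfl
  | tail _ h ih => exact ih.trans (RightStep.fst_le h)

/-- The preorder of chains of moves upwards and along fibres, either all to the right or all to
the left. -/
def MoveRel (π : ℝ × ℝ → Q) (A : Set Q) (p q : ℝ × ℝ) : Prop :=
  RightRel π A p q ∨ RightRel (π ∘ mirror) A (mirror p) (mirror q)

theorem MoveRel.mirrored {π : ℝ × ℝ → Q} {A : Set Q} {p q : ℝ × ℝ} (h : MoveRel π A p q) :
    MoveRel (π ∘ mirror) A (mirror p) (mirror q) := by
  rcases h with h | h
  · refine Or.inr ?_
    simpa [Function.comp_def] using h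
  · exact Or.inl h

variable [TopologicalSpace Q]

/-- The fibres of `π` over `A` are connected graphs over intervals of length at least `η`,
all contained in the box of radius `M`. -/
structure WideGraphFamily (π : ℝ × ℝ → Q) (A : Set Q) (M η : ℝ) : Prop where
  cont : Continuous π
  closed : IsClosed A
  box : ∀ p, π p ∈ A → ‖p‖ ≤ M
  conn : ∀ q ∈ A, IsPreconnected (π ⁻¹' {q})
  inj : ∀ q ∈ A, InjOn Prod.fst (π ⁻¹' {q})
  wide : ∀ q ∈ A, ∃ p p', π p = q ∧ π p' = q ∧ p.1 + η ≤ p'.1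

theorem exists_continuousOn_graph {K : Set (ℝ × ℝ)} (hK : IsCompact K) (hinj : InjOn Prod.fst K) :
    ∃ γ : ℝ → ℝ, ContinuousOn γ (Prod.fst '' K) ∧ ∀ p ∈ K, γ p.1 = p.2 := by
  have : CompactSpace K := isCompact_iff_compactSpace.1 hK
  let f : K → ℝ := fun p => p.1.1
  have hf : Continuous f := by fun_prop
  have hfi : Function.Injective f := fun a b h => Subtype.ext (hinj a.2 b.2 h)
  have he := (hf.isClosedEmbedding hfi).isEmbedding
  refine ⟨Function.extend f (fun p => p.1.2) 0, ?_, fun p hp => hfi.extend_apply _ _ ⟨p, hp⟩⟩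
  have hr : Prod.fst '' K = range f := by
    ext x
    simp [f]
  rw [hr, continuousOn_iff_continuous_domRestrict]
  have : (range f).domRestrict (Function.extend f (fun p => p.1.2) 0) =
      (fun p : K => p.1.2) ∘ he.toHomeomorph.symm := by
    funext ⟨x, ⟨p, hp⟩⟩
    subst hp
    have : he.toHomeomorph.symm ⟨f p, mem_range_self p⟩ = p :=
      (Homeomorph.symm_apply_eq _).2 rfl
    simp only [domRestrict_apply, Function.comp_apply, this]
    exact hfi.extend_apply _ _ p
  rw [this]
  fun_prop

theorem UpRel.refl (p : ℝ × ℝ) : UpRel p p := ⟨rfl, le_rfl⟩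

theorem UpRel.trans {p q r : ℝ × ℝ} (h : UpRel p q) (h' : UpRel q r) : UpRel p r :=
  ⟨h.1.trans h'.1, h.2.trans h'.2⟩

namespace WideGraphFamily

variable {π : ℝ × ℝ → Q} {A : Set Q} {M η : ℝ}

theorem isCompact_fiber [T1Space Q] (H : WideGraphFamily π A M η) {q : Q} (hq : q ∈ A) :
    IsCompact (π ⁻¹' {q}) :=
  (isCompact_closedBall (0 : ℝ × ℝ) M).of_isClosed_subset
    (isClosed_singleton.preimage H.cont)
    fun p hp => mem_closedBall_zero_iff.2 (H.box p (by rw [show π p = q from hp]; exact hq))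

theorem mirrored (H : WideGraphFamily π A M η) : WideGraphFamily (π ∘ mirror) A M η where
  cont := H.cont.comp mirror.continuous
  closed := H.closed
  box p hp := by
    have := H.box _ hp
    rwa [norm_mirror] at this
  conn q hq := by
    have := (H.conn q hq).image _ mirror.symm.continuous.continuousOn
    rwa [mirror.image_symm] at this
  inj q hq := by
    intro a ha b hb hab
    have := H.inj q hq (x₁ := mirror a) (x₂ := mirror b) ha hb (by simp [hab])
    exact mirror.injective this
  wide q hq := by
    obtain ⟨p, p', hp, hp', h⟩ := H.wide q hq
    refine ⟨mirror p', mirror p, by simpa, by simpa, ?_⟩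
    simp only [mirror_fst]
    linarith

theorem exists_mem_fiber (H : WideGraphFamily π A M η) {a b : ℝ × ℝ} (hab : π a = π b)
    (ha : π a ∈ A) {x : ℝ} (h1 : a.1 ≤ x) (h2 : x ≤ b.1) : ∃ c, π c = π a ∧ c.1 = x := by
  have h := ((H.conn _ ha).image Prod.fst continuous_fst.continuousOn).ordConnected
  obtain ⟨c, hc, hcx⟩ := h.out (mem_image_of_mem _ (show a ∈ π ⁻¹' {π a} from rfl))
    (mem_image_of_mem _ (show b ∈ π ⁻¹' {π a} from hab.symm)) ⟨h1, h2⟩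
  exact ⟨c, hc, hcx⟩

theorem eq_of_fst_eq (H : WideGraphFamily π A M η) {a b : ℝ × ℝ} (hab : π a = π b)
    (ha : π a ∈ A) (h : a.1 = b.1) : a = b :=
  H.inj _ ha (show a ∈ π ⁻¹' {π a} from rfl) hab.symm h

/-- Distinct fibres over `A` do not cross. -/
theorem lt_of_lt [T1Space Q] (H : WideGraphFamily π A M η) {r s t u : ℝ × ℝ} (hrs : π r = π s)
    (hr : π r ∈ A) (htu : π t = π u) (ht : π t ∈ A) (hx : t.1 = r.1) (hx' : u.1 = s.1)
    (hle : r.1 ≤ s.1) (hlt : t.2 < r.2) : u.2 < s.2 := by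
  by_contra! hcon
  have hne : π r ≠ π t := by
    intro h
    rw [H.eq_of_fst_eq h hr hx.symm] at hlt
    exact lt_irrefl _ hlt
  obtain ⟨γ, hγ, hγ'⟩ := exists_continuousOn_graph (H.isCompact_fiber hr) (H.inj _ hr)
  obtain ⟨δ, hδ, hδ'⟩ := exists_continuousOn_graph (H.isCompact_fiber ht) (H.inj _ ht)
  have hsub1 : Icc r.1 s.1 ⊆ Prod.fst '' (π ⁻¹' {π r}) := by
    rintro x ⟨h1, h2⟩
    obtain ⟨c, hc, hcx⟩ := H.exists_mem_fiber hrs hr h1 h2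
    exact ⟨c, hc, hcx⟩
  have hsub2 : Icc r.1 s.1 ⊆ Prod.fst '' (π ⁻¹' {π t}) := by
    rintro x ⟨h1, h2⟩
    obtain ⟨c, hc, hcx⟩ := H.exists_mem_fiber htu ht (hx ▸ h1) (hx' ▸ h2)
    exact ⟨c, hc, hcx⟩
  have hc := (hγ.mono hsub1).sub (hδ.mono hsub2)
  have hI := intermediate_value_Icc' hle hc
  have e1 := hγ' r rfl
  have e2 := hγ' s hrs.symm
  have e3 := hδ' t rfl
  have e4 := hδ' u htu.symm
  rw [hx] at e3
  rw [hx'] at e4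
  obtain ⟨x, hxI, hx0⟩ := hI (show (0 : ℝ) ∈ Icc _ _ from
    ⟨by simp only [Pi.sub_apply]; linarith, by simp only [Pi.sub_apply]; linarith⟩)
  obtain ⟨c, hc, hcx⟩ := hsub1 hxI
  obtain ⟨d, hd, hdx⟩ := hsub2 hxI
  have f1 := hγ' c hc
  have f2 := hδ' d hd
  rw [hcx] at f1
  rw [hdx] at f2
  simp only [Pi.sub_apply] at hx0
  have : c = d := Prod.ext (hcx.trans hdx.symm) (by linarith)
  subst this
  exact hne (hc.symm.trans hd)

theorem snd_le (H : WideGraphFamily π A M η) {p q : ℝ × ℝ} (h : RightRel π A p q) :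
    p.1 = q.1 → p.2 ≤ q.2 := by
  induction h with
  | refl => exact fun _ => le_rfl
  | @tail r q h h' ih =>
    intro he
    have h1 := (RightRel.fst_le h)
    have h2 := (RightStep.fst_le h')
    have h3 := ih (by linarith)
    rcases h' with h' | h'
    · exact h3.trans h'.2
    · rwa [← H.eq_of_fst_eq h'.1 h'.2.1 (by linarith)]

/-- A chain of moves to the right starting above a fibre over `A` stays above this fibre. -/
theorem above_of_above [T1Space Q] (H : WideGraphFamily π A M η) {s s' : ℝ × ℝ}
    (h : RightRel π A s s') {t : ℝ × ℝ} (ht : π t ∈ A) (htx : t.1 = s.1) :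
    ∀ t', π t = π t' → t'.1 = s'.1 →
      (t.2 < s.2 → t'.2 < s'.2) ∧ (t.2 ≤ s.2 → t'.2 ≤ s'.2) := by
  induction h with
  | refl =>
    intro t' htt' hx
    rw [H.eq_of_fst_eq htt' ht (htx.trans hx.symm)]
    exact ⟨id, id⟩
  | @tail r q h h' ih =>
    intro t' htt' hx
    obtain ⟨t'', h1, h2⟩ := H.exists_mem_fiber htt' ht
      (x := r.1) (htx.trans_le (RightRel.fst_le h)) ((RightStep.fst_le h').trans_eq hx.symm)
    have := ih t'' h1.symm h2
    rcases h' with h' | h'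
    · have e : t'' = t' := H.eq_of_fst_eq (h1.trans htt') (h1 ▸ ht) (h2.trans (h'.1.trans hx.symm))
      subst e
      exact ⟨fun h => (this.1 h).trans_le h'.2, fun h => (this.2 h).trans h'.2⟩
    · have key := H.lt_of_lt (t := t'') (u := t') h'.1 h'.2.1 (h1.trans htt') (h1 ▸ ht) h2 hx h'.2.2
      refine ⟨fun h => key (this.1 h), fun h => ?_⟩
      rcases (this.2 h).lt_or_eq with h3 | h3
      · exact (key h3).le
      · have e : t'' = r := Prod.ext h2 h3
        subst e
        have e2 : t' = q := H.eq_of_fst_eq (htt'.symm.trans (h1.symm.trans h'.1)) (htt' ▸ ht) hx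
        rw [e2]

theorem exists_between (H : WideGraphFamily π A M η) {p q : ℝ × ℝ} (h : RightRel π A p q) :
    ∀ x, p.1 ≤ x → x ≤ q.1 → ∃ s, s.1 = x ∧ RightRel π A p s ∧ RightRel π A s q ∧
      (s = p ∨ s = q ∨ π s ∈ A) := by
  induction h with
  | refl =>
    intro x h1 h2
    exact ⟨p, le_antisymm h1 h2, .refl, .refl, Or.inl rfl⟩
  | @tail r q h h' ih =>
    intro x h1 h2
    rcases h2.eq_or_lt with h2 | h2
    · exact ⟨q, h2.symm, h.tail h', .refl, Or.inr (Or.inl rfl)⟩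
    rcases le_or_gt x r.1 with h3 | h3
    · obtain ⟨s, hs, h4, h5, h6⟩ := ih x h1 h3
      refine ⟨s, hs, h4, h5.tail h', ?_⟩
      rcases h6 with h6 | h6 | h6
      · exact Or.inl h6
      · rcases h' with h' | h'
        · rw [← h6] at h'
          exact absurd (hs.symm.trans h'.1) h2.ne
        · rw [h6]
          exact Or.inr (Or.inr h'.2.1)
      · exact Or.inr (Or.inr h6)
    · rcases h' with h' | h'
      · linarith [h'.1]
      · obtain ⟨c, hc, hcx⟩ := H.exists_mem_fiber h'.1 h'.2.1 h3.le h2.le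
        refine ⟨c, hcx, h.tail (Or.inr ⟨hc.symm, h'.2.1, by linarith⟩),
          .single (Or.inr ⟨hc.trans h'.1, hc ▸ h'.2.1, by linarith⟩), Or.inr (Or.inr ?_)⟩
        rw [hc]
        exact h'.2.1

end WideGraphFamily

namespace WideGraphFamily

variable {π : ℝ × ℝ → Q} {A : Set Q} {M η : ℝ}

theorem moveRel_of_right_of_leftStep [T1Space Q] (H : WideGraphFamily π A M η) {p q r : ℝ × ℝ}
    (h : RightRel π A p q) (h' : RightStep (π ∘ mirror) A (mirror q) r) :
    MoveRel π A p (mirror r) := by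
  obtain ⟨r, rfl⟩ := mirror.surjective r
  simp only [mirror_mirror]
  rcases h' with h' | h'
  · refine Or.inl (h.tail (Or.inl ⟨?_, h'.2⟩))
    simpa using h'.1
  simp only [Function.comp_apply, mirror_mirror, mirror_fst, neg_le_neg_iff] at h'
  obtain ⟨h1, h2, h3⟩ := h'
  rcases le_or_gt p.1 r.1 with h4 | h4
  · obtain ⟨s, hs, h5, h6, -⟩ := H.exists_between h r.1 h4 h3
    rcases le_or_gt s.2 r.2 with h7 | h7
    · exact Or.inl (h5.tail (Or.inl ⟨hs, h7⟩))
    · exact absurd ((H.above_of_above h6 (h1 ▸ h2) hs.symm q h1.symm rfl).1 h7) (lt_irrefl _)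
  · obtain ⟨t, ht, htx⟩ := H.exists_mem_fiber h1.symm (h1 ▸ h2) h4.le (RightRel.fst_le h)
    rcases le_or_gt p.2 t.2 with h7 | h7
    · refine Or.inr (.tail (.single (b := mirror t) (Or.inl ⟨?_, h7⟩))
        (Or.inr ⟨?_, ?_, ?_⟩))
      · simp [htx]
      · simpa using ht
      · simp only [Function.comp_apply, mirror_mirror]
        rw [ht, ← h1]
        exact h2
      · simp only [mirror_fst]
        linarith
    · refine absurd ((H.above_of_above h (t := t) ?_ htx q (ht.trans h1.symm) rfl).1 h7)
        (lt_irrefl _)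
      rw [ht, ← h1]
      exact h2

theorem moveRel_trans_right [T1Space Q] (H : WideGraphFamily π A M η) {p q r : ℝ × ℝ}
    (h : MoveRel π A p q) (h' : RightRel π A q r) : MoveRel π A p r := by
  induction h' with
  | refl => exact h
  | @tail s r h1 h2 ih =>
    rcases ih with ih | ih
    · exact Or.inl (ih.tail h2)
    · have h3 : RightStep ((π ∘ mirror) ∘ mirror) A
          (mirror (mirror s)) r := by
        simpa [Function.comp_def] using h2
      have := H.mirrored.moveRel_of_right_of_leftStep ih h3
      rcases this with h | h
      · exact Or.inr h
      · refine Or.inl ?_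
        simpa [Function.comp_def] using h

theorem moveRel_trans [T1Space Q] (H : WideGraphFamily π A M η) {p q r : ℝ × ℝ}
    (h : MoveRel π A p q) (h' : MoveRel π A q r) : MoveRel π A p r := by
  rcases h' with h' | h'
  · exact H.moveRel_trans_right h h'
  · have := (H.mirrored.moveRel_trans_right h.mirrored h').mirrored
    simpa [Function.comp_def] using this

theorem snd_le_of_moveRel (H : WideGraphFamily π A M η) {p q : ℝ × ℝ} (h : MoveRel π A p q)
    (he : p.1 = q.1) : p.2 ≤ q.2 := by
  rcases h with h | h
  · exact H.snd_le h he
  · simpa using H.mirrored.snd_le h (by simp [he])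

end WideGraphFamily

end Straightening

theorem isClosed_relComp {X : Type*} [TopologicalSpace X] [T2Space X] [FirstCountableTopology X]
    (B : Set X) (hB : IsCompact B) (E E' : X → X → Prop)
    (hE : IsClosed {z : X × X | E z.1 z.2}) (hE' : IsClosed {z : X × X | E' z.1 z.2}) :
    IsClosed {z : X × X | ∃ r ∈ B, E z.1 r ∧ E' r z.2} := by
  have : CompactSpace B := isCompact_iff_compactSpace.1 hB
  have hcl : IsClosed {w : (X × X) × B | E w.1.1 w.2 ∧ E' w.2 w.1.2} :=
    (hE.preimage (f := fun w : (X × X) × B => (w.1.1, (w.2 : X))) (by fun_prop)).inter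
      (hE'.preimage (f := fun w : (X × X) × B => ((w.2 : X), w.1.2)) (by fun_prop))
  convert isClosedMap_fst_of_compactSpace _ hcl using 1
  ext z
  constructor
  · rintro ⟨r, hr, h⟩
    exact ⟨(z, ⟨r, hr⟩), h, rfl⟩
  · rintro ⟨⟨z, r⟩, h, rfl⟩
    exact ⟨r, r.2, h⟩

section Straightening

variable {Q : Type*}

/-- Equality, or a move to the right along a fibre over `A`. -/
def FiberStep (π : ℝ × ℝ → Q) (A : Set Q) (p q : ℝ × ℝ) : Prop :=
  p = q ∨ (π p = π q ∧ π p ∈ A ∧ p.1 ≤ q.1)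

/-- A chain of three moves with corners in the box of radius `M`: up, along a fibre, up. -/
def ShortChain (π : ℝ × ℝ → Q) (A : Set Q) (M : ℝ) (p q : ℝ × ℝ) : Prop :=
  ∃ b ∈ closedBall (0 : ℝ × ℝ) M, (∃ a ∈ closedBall (0 : ℝ × ℝ) M, UpRel p a ∧
    FiberStep π A a b) ∧ UpRel b q

/-- Concatenations of `2 * (n + 1)` short chains. -/
def LongChain (π : ℝ × ℝ → Q) (A : Set Q) (M : ℝ) : ℕ → ℝ × ℝ → ℝ × ℝ → Prop
  | 0, p, q => ∃ b ∈ closedBall (0 : ℝ × ℝ) M, ShortChain π A M p b ∧ ShortChain π A M b q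
  | n + 1, p, q => ∃ b ∈ closedBall (0 : ℝ × ℝ) M, LongChain π A M n p b ∧ LongChain π A M 0 b q

theorem longChain_zero {π : ℝ × ℝ → Q} {A : Set Q} {M : ℝ} {p q : ℝ × ℝ} :
    LongChain π A M 0 p q ↔
      ∃ b ∈ closedBall (0 : ℝ × ℝ) M, ShortChain π A M p b ∧ ShortChain π A M b q := by
  rw [LongChain]

theorem longChain_succ {π : ℝ × ℝ → Q} {A : Set Q} {M : ℝ} {n : ℕ} {p q : ℝ × ℝ} :
    LongChain π A M (n + 1) p q ↔
      ∃ b ∈ closedBall (0 : ℝ × ℝ) M, LongChain π A M n p b ∧ LongChain π A M 0 b q := by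
  rw [LongChain]

theorem FiberStep.rightRel {π : ℝ × ℝ → Q} {A : Set Q} {p q : ℝ × ℝ} (h : FiberStep π A p q) :
    RightRel π A p q := by
  rcases h with rfl | h
  · exact .refl
  · exact .single (Or.inr h)

theorem ShortChain.rightRel {π : ℝ × ℝ → Q} {A : Set Q} {M : ℝ} {p q : ℝ × ℝ}
    (h : ShortChain π A M p q) : RightRel π A p q := by
  obtain ⟨b, -, ⟨a, -, h1, h2⟩, h3⟩ := h
  have h1' : RightRel π A p a := .single (Or.inl h1)
  exact (h1'.trans h2.rightRel).tail (Or.inl h3)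

theorem LongChain.rightRel {π : ℝ × ℝ → Q} {A : Set Q} {M : ℝ} {n : ℕ} :
    ∀ {p q : ℝ × ℝ}, LongChain π A M n p q → RightRel π A p q := by
  induction n with
  | zero =>
    intro p q h
    obtain ⟨b, -, h1, h2⟩ := longChain_zero.1 h
    exact h1.rightRel.trans h2.rightRel
  | succ n ih =>
    intro p q h
    obtain ⟨b, -, h1, h⟩ := longChain_succ.1 h
    obtain ⟨c, -, h2, h3⟩ := longChain_zero.1 h
    exact (ih h1).trans (h2.rightRel.trans h3.rightRel)

variable [TopologicalSpace Q]

namespace WideGraphFamily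

variable {π : ℝ × ℝ → Q} {A : Set Q} {M η : ℝ}

theorem isClosed_longChain [T2Space Q] (H : WideGraphFamily π A M η) (n : ℕ) :
    IsClosed {z : (ℝ × ℝ) × (ℝ × ℝ) | LongChain π A M n z.1 z.2} := by
  have hB := isCompact_closedBall (0 : ℝ × ℝ) M
  have hπ := H.cont
  have hU : IsClosed {z : (ℝ × ℝ) × (ℝ × ℝ) | UpRel z.1 z.2} :=
    (isClosed_eq (by fun_prop) (by fun_prop)).and (isClosed_le (by fun_prop) (by fun_prop))
  have hF : IsClosed {z : (ℝ × ℝ) × (ℝ × ℝ) | FiberStep π A z.1 z.2} :=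
    isClosed_or (isClosed_eq (by fun_prop) (by fun_prop))
      ((isClosed_eq (by fun_prop) (by fun_prop)).and
        ((H.closed.preimage (f := fun z : (ℝ × ℝ) × (ℝ × ℝ) => π z.1) (by fun_prop)).and
        (isClosed_le (by fun_prop) (by fun_prop))))
  have hS : IsClosed {z : (ℝ × ℝ) × (ℝ × ℝ) | ShortChain π A M z.1 z.2} :=
    isClosed_relComp _ hB
      (fun p b => ∃ a ∈ closedBall (0 : ℝ × ℝ) M, UpRel p a ∧ FiberStep π A a b) _
      (isClosed_relComp _ hB _ _ hU hF) hU
  have h0 : IsClosed {z : (ℝ × ℝ) × (ℝ × ℝ) | LongChain π A M 0 z.1 z.2} := by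
    simp only [longChain_zero]
    exact isClosed_relComp _ hB _ _ hS hS
  induction n with
  | zero => exact h0
  | succ n ih =>
    simp only [longChain_succ]
    exact isClosed_relComp _ hB _ _ ih h0

theorem mem_box (H : WideGraphFamily π A M η) {p : ℝ × ℝ} (h : π p ∈ A) :
    p ∈ closedBall (0 : ℝ × ℝ) M :=
  mem_closedBall_zero_iff.2 (H.box p h)

theorem longChain_of_lt [T1Space Q] (H : WideGraphFamily π A M η) {p q : ℝ × ℝ}
    (hp : p ∈ closedBall (0 : ℝ × ℝ) M) (hq : q ∈ closedBall (0 : ℝ × ℝ) M)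
    (h : RightRel π A p q) (hpq : q.1 < p.1 + η) : LongChain π A M 0 p q := by
  suffices ∀ r, RightRel π A r q → RightRel π A p r → ShortChain π A M p r →
      LongChain π A M 0 p q from
    this p h .refl ⟨p, hp, ⟨p, hp, .refl p, Or.inl rfl⟩, .refl p⟩
  intro r hr
  induction hr using Relation.ReflTransGen.head_induction_on with
  | refl =>
    exact fun _ h => longChain_zero.2
      ⟨q, hq, h, q, hq, ⟨q, hq, .refl q, Or.inl rfl⟩, .refl q⟩
  | @head r s hrs hsq ih =>
    intro hpr hsh
    rcases id hrs with h' | h'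
    · refine ih (hpr.tail hrs) ?_
      obtain ⟨b, hb, h1, h2⟩ := hsh
      exact ⟨b, hb, h1, h2.trans h'⟩
    have hpr' := RightRel.fst_le hpr
    have hsq' := RightRel.fst_le hsq
    obtain ⟨u, v, hu, hv, huv⟩ := H.wide _ h'.2.1
    rcases le_or_gt u.1 p.1 with h3 | h3
    · obtain ⟨t, ht, htx⟩ := H.exists_mem_fiber hu (hu.symm ▸ h'.2.1) h3 hpr'
      have htr : π t = π r := ht.trans hu
      have htA : π t ∈ A := htr ▸ h'.2.1
      refine ih (hpr.tail hrs) ⟨s, H.mem_box (h'.1 ▸ h'.2.1), ⟨t, H.mem_box htA,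
        ⟨htx.symm, ?_⟩, Or.inr ⟨htr.trans h'.1, htA, ?_⟩⟩, .refl s⟩
      · by_contra! hcon
        exact lt_irrefl _ ((H.above_of_above hpr htA htx r htr rfl).1 hcon)
      · rw [htx]
        exact hpr'.trans h'.2.2
    · have h4 : q.1 ≤ v.1 := by linarith
      obtain ⟨t, ht, htx⟩ := H.exists_mem_fiber (h'.1.symm.trans hv.symm) (h'.1 ▸ h'.2.1) hsq' h4
      have htA : π t ∈ A := by
        rw [ht, ← h'.1]
        exact h'.2.1
      refine longChain_zero.2 ⟨r, H.mem_box h'.2.1, hsh, t, H.mem_box htA, ⟨r, H.mem_box h'.2.1, .refl r,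
        Or.inr ⟨h'.1.trans ht.symm, h'.2.1, ?_⟩⟩, htx, ?_⟩
      · rw [htx]
        exact h'.2.2.trans hsq'
      · exact (H.above_of_above hsq (h'.1 ▸ h'.2.1) rfl t ht.symm htx).2 le_rfl

theorem longChain_of_le [T1Space Q] (H : WideGraphFamily π A M η) (hη : 0 < η) (n : ℕ) :
    ∀ {p q : ℝ × ℝ}, p ∈ closedBall (0 : ℝ × ℝ) M → q ∈ closedBall (0 : ℝ × ℝ) M →
    RightRel π A p q → q.1 ≤ p.1 + (n + 1) * (η / 2) → LongChain π A M n p q := by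
  induction n with
  | zero =>
    intro p q hp hq h hpq
    refine H.longChain_of_lt hp hq h (hpq.trans_lt ?_)
    norm_num
    linarith
  | succ n ih =>
    intro p q hp hq h hpq
    have h0 := RightRel.fst_le h
    obtain ⟨s, hs, h1, h2, h3⟩ := H.exists_between h (max p.1 (q.1 - η / 2)) (le_max_left _ _)
      (max_le h0 (by linarith))
    have hsB : s ∈ closedBall (0 : ℝ × ℝ) M := by
      rcases h3 with rfl | rfl | h3
      exacts [hp, hq, H.mem_box h3]
    refine longChain_succ.2 ⟨s, hsB, ih hp hsB h1 ?_, H.longChain_of_lt hsB hq h2 ?_⟩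
    · rw [hs]
      refine max_le ?_ ?_
      · have : (0 : ℝ) ≤ (n + 1) * (η / 2) := by positivity
        linarith
      · push_cast at hpq
        linarith
    · rw [hs]
      linarith [le_max_right p.1 (q.1 - η / 2)]

theorem isClosed_rightRel [T2Space Q] (H : WideGraphFamily π A M η) (hη : 0 < η) :
    IsClosed {z : (ℝ × ℝ) × (ℝ × ℝ) | ‖z‖ ≤ M ∧ RightRel π A z.1 z.2} := by
  obtain ⟨n, hn⟩ := exists_nat_gt (2 * M / (η / 2))
  rw [div_lt_iff₀ (by positivity)] at hn
  convert (isClosed_le (f := fun z : (ℝ × ℝ) × (ℝ × ℝ) => ‖z‖) (g := fun _ => M)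
    (by fun_prop) (by fun_prop)).and (H.isClosed_longChain n) using 1
  ext ⟨p, q⟩
  refine and_congr_right fun hz => ⟨fun h => ?_, fun h => LongChain.rightRel h⟩
  rw [Prod.norm_def, max_le_iff] at hz
  have h1 := abs_le.1 ((norm_fst_le p).trans hz.1)
  have h2 := abs_le.1 ((norm_fst_le q).trans hz.2)
  refine H.longChain_of_le hη n (mem_closedBall_zero_iff.2 hz.1)
    (mem_closedBall_zero_iff.2 hz.2) h ?_
  simp only
  linarith

theorem isClosed_moveRel [T2Space Q] (H : WideGraphFamily π A M η) (hη : 0 < η) :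
    IsClosed {z : (ℝ × ℝ) × (ℝ × ℝ) | ‖z‖ ≤ M ∧ MoveRel π A z.1 z.2} := by
  have h1 := H.isClosed_rightRel hη
  have h2 := (H.mirrored.isClosed_rightRel hη).preimage
    (f := fun z : (ℝ × ℝ) × (ℝ × ℝ) => (mirror z.1, mirror z.2)) (by fun_prop)
  convert h1.union h2 using 1
  ext z
  simp only [MoveRel, mem_union, mem_preimage, mem_ofPred_eq]
  have : ‖(mirror z.1, mirror z.2)‖ = ‖z‖ := by
    rw [Prod.norm_def, Prod.norm_def (x := z), norm_mirror, norm_mirror]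
  rw [this, and_or_left]

/-- A continuous function, strictly increasing on vertical lines, and constant on the fibres. -/
theorem exists_straightening [T2Space Q] (H : WideGraphFamily π A M η) (hη : 0 < η) (hM : 0 < M) :
    ∃ F : ℝ × ℝ → ℝ, Continuous F ∧ (∀ x, StrictMono fun y => F (x, y)) ∧
      (∀ x, Function.Surjective fun y => F (x, y)) ∧
      ∀ p p', π p = π p' → π p ∈ A → F p = F p' := by
  obtain ⟨f, hf, hfc, hfm, hfs⟩ := exists_strictly_monotone_on_box M hM (MoveRel π A)
    (fun a => Or.inl .refl) (fun a b c => H.moveRel_trans) (H.isClosed_moveRel hη)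
  have hcl := continuous_clamp M
  have hF : Continuous fun p : ℝ × ℝ => f p + (p.2 - clamp M p.2) := by fun_prop
  have hn : ∀ x y, ‖((clamp M x, clamp M y) : ℝ × ℝ)‖ ≤ M := fun x y =>
    max_le (clamp_mem hM.le _) (clamp_mem hM.le _)
  refine ⟨fun p => f p + (p.2 - clamp M p.2), hF, ?_, ?_, ?_⟩
  · intro x a b hab
    have h1 : f (x, a) ≤ f (x, b) := by
      rw [hfc (x, a), hfc (x, b)]
      exact hfm _ _ (hn _ _) (hn _ _)
        (Or.inl (.single (Or.inl ⟨rfl, clamp_monotone M hab.le⟩)))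
    have h2 := sub_clamp_monotone (M := M) hab.le
    simp only at h2 ⊢
    rcases h2.lt_or_eq with h3 | h3
    · linarith
    obtain ⟨h4, h5⟩ := abs_le_of_sub_clamp_eq hM.le hab h3
    rw [h3]
    refine (add_lt_add_iff_right _).2 ?_
    rw [hfc (x, a), hfc (x, b)]
    refine hfs _ _ (hn _ _) (hn _ _)
      (Or.inl (.single (Or.inl ⟨rfl, clamp_monotone M hab.le⟩))) fun h => ?_
    have := H.snd_le_of_moveRel h rfl
    simp only [clamp_of_mem h4, clamp_of_mem h5] at this
    linarith
  · intro x
    obtain ⟨C, hC⟩ := (isCompact_closedBall (0 : ℝ × ℝ) M).exists_bound_of_continuousOn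
      (f := fun p => f p - p.2) (by fun_prop)
    refine surjective_of_bounded_displacement _ (hF.comp (by fun_prop)) C fun y => ?_
    have := hC _ (mem_closedBall_zero_iff.2 (hn x y))
    simp only at this ⊢
    rw [hfc (x, y)]
    simp only
    convert this using 1
    rw [Real.norm_eq_abs]
    congr 1
    ring
  · intro p p' h hA
    have key : ∀ p p', π p = π p' → π p ∈ A → MoveRel π A p p' := by
      intro p p' h hA
      rcases le_total p.1 p'.1 with h1 | h1
      · exact Or.inl (.single (Or.inr ⟨h, hA, h1⟩))
      · refine Or.inr (.single (Or.inr ⟨?_, ?_, ?_⟩))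
        · simpa using h
        · simpa using hA
        · simpa using h1
    have hp := H.box p hA
    have hp' := H.box p' (h ▸ hA)
    have e : f p = f p' := le_antisymm (hfm p p' hp hp' (key p p' h hA))
      (hfm p' p hp' hp (key p' p h.symm (h ▸ hA)))
    simp only
    rw [e, clamp_of_mem ((norm_snd_le p).trans hp), clamp_of_mem ((norm_snd_le p').trans hp')]
    ring

end WideGraphFamily

end Straightening

/-- Homeomorphisms of the plane shrink all fibres over `A` while moving points only slightly as
measured after applying `π`. -/
def Shrinkable {Q : Type*} [PseudoMetricSpace Q] (π : ℝ × ℝ → Q) (A : Set Q) : Prop :=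
  ∀ ε > 0, ∃ θ : ℝ × ℝ ≃ₜ ℝ × ℝ, (∀ p, dist (π (θ p)) (π p) < ε) ∧
    ∀ p p', π p = π p' → π p ∈ A → dist (θ p) (θ p') < ε

theorem exists_pos_le_of_isCompact {X : Type*} [TopologicalSpace X] {K : Set X} (hK : IsCompact K)
    {g : X → ℝ} (hg : ContinuousOn g K) (hpos : ∀ x ∈ K, 0 < g x) : ∃ m > 0, ∀ x ∈ K, m ≤ g x := by
  rcases K.eq_empty_or_nonempty with rfl | hne
  · exact ⟨1, one_pos, by simp⟩
  · obtain ⟨x, hx, hmin⟩ := hK.exists_isMinOn hne hg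
    exact ⟨g x, hpos x hx, fun y hy => isMinOn_iff.1 hmin y hy⟩

section GraphShrinking

variable {Q : Type*} [MetricSpace Q]

theorem exists_snd_close_of_fst_close [ProperSpace Q] {π : ℝ × ℝ → Q} (hπ : IsProperMap π)
    {A : Set Q} (hA : IsCompact A) (hinj : ∀ q ∈ A, InjOn Prod.fst (π ⁻¹' {q})) {ε : ℝ}
    (hε : 0 < ε) : ∃ ρ > 0, ∀ q ∈ A, ∀ p p', dist (π p) q ≤ ρ → dist (π p') q ≤ ρ →
      |p.1 - p'.1| ≤ ρ → |p.2 - p'.2| < ε := by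
  have hK1 : IsCompact (π ⁻¹' cthickening 1 A) := hπ.isCompact_preimage hA.cthickening
  have hc := hπ.continuous
  let K : Set ((ℝ × ℝ) × (ℝ × ℝ) × Q) :=
    ((π ⁻¹' cthickening 1 A) ×ˢ (π ⁻¹' cthickening 1 A) ×ˢ A) ∩ {z | ε ≤ |z.1.2 - z.2.1.2|}
  have hK : IsCompact K := (hK1.prod (hK1.prod hA)).inter_right
    (isClosed_le (by fun_prop) (by fun_prop))
  obtain ⟨m, hm, hmin⟩ := exists_pos_le_of_isCompact hK
    (g := fun z => dist (π z.1) z.2.2 + dist (π z.2.1) z.2.2 + |z.1.1 - z.2.1.1|)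
    (by fun_prop) (by
      rintro ⟨p, p', q⟩ ⟨⟨-, -, hq⟩, hz⟩
      simp only [mem_ofPred_eq] at hz hq ⊢
      by_contra! hcon
      have h1 := dist_nonneg (x := π p) (y := q)
      have h2 := dist_nonneg (x := π p') (y := q)
      have h3 := abs_nonneg (p.1 - p'.1)
      have e1 : π p = q := dist_le_zero.1 (by linarith)
      have e2 : π p' = q := dist_le_zero.1 (by linarith)
      have e3 : p.1 = p'.1 := by
        have := abs_eq_zero.1 (le_antisymm (by linarith) h3)
        linarith
      have := hinj q hq e1 e2 e3
      rw [this, sub_self, abs_zero] at hz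
      linarith)
  refine ⟨min 1 (m / 4), by positivity, fun q hq p p' h1 h2 h3 => ?_⟩
  by_contra! hcon
  have h1' := h1.trans (min_le_left _ _)
  have h2' := h2.trans (min_le_left _ _)
  have := hmin (p, p', q) ⟨⟨mem_cthickening_of_dist_le _ _ _ _ hq h1',
    mem_cthickening_of_dist_le _ _ _ _ hq h2', hq⟩, hcon⟩
  have h1'' := h1.trans (min_le_right _ _)
  have h2'' := h2.trans (min_le_right _ _)
  have h3'' := h3.trans (min_le_right _ _)
  simp only at this
  linarith

/-- Averages of expansions of a vertical collapse, flattening all fibres over `A`. -/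
theorem exists_layers (π : ℝ × ℝ → Q) (hπ : Continuous π) {A A' : Set Q}
    {M η τ : ℝ} (hM : 0 < M) (hη : 0 < η) (hτ : 0 < τ) {W : ℝ × ℝ → ℝ} (hA : IsCompact (π ⁻¹' A))
    (hbox : ∀ p, π p ∈ A → |p.1| ≤ M ∧ |p.2| ≤ M)
    (hfst : ∀ p p', π p = π p' → π p ∈ A' → p.1 = p'.1)
    (hsmall : ∀ p p', π p = π p' → π p ∈ A → π p ∉ A' → |p.2 - p'.2| ≤ η)
    (hW : Continuous W) (hWm : ∀ x, Monotone fun y => W (x, y))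
    (hWo : ∀ p : ℝ × ℝ, M ≤ |p.1| ∨ M ≤ |p.2| → W p = p.2)
    (hWe : ∀ x y y', W (x, y) = W (x, y') ↔
      (y = y' ∨ (π (x, y) = π (x, y') ∧ π (x, y) ∈ A'))) (m : ℕ) :
    ∃ s : ℝ × ℝ → ℝ, Continuous s ∧ (∀ x, Monotone fun y => s (x, y)) ∧
      (∀ p : ℝ × ℝ, M ≤ |p.1| ∨ M ≤ |p.2| → s p = m * p.2) ∧
      (∀ p p', π p = π p' → π p ∈ A' → s p = s p') ∧
      (∀ p p', π p = π p' → π p ∈ A → |s p - s p'| ≤ 2 * η * m + 2 * M) ∧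
      (∀ p t, W p + τ < W (p.1, t) → s p ≤ m * t) ∧
      (∀ p t, W (p.1, t) < W p - τ → m * t ≤ s p) := by
  induction m with
  | zero =>
    refine ⟨fun _ => 0, continuous_const, fun _ => monotone_const, by simp, by simp, ?_, by simp,
      by simp⟩
    intro p p' _ _
    simp
    exact hM.le
  | succ m ih =>
    obtain ⟨s, hs, hsm, hso, hsc, hosc, hup, hdn⟩ := ih
    let D : Set (ℝ × ℝ) := {p | π p ∈ A ∧ ∃ p₁ p₂, π p₁ = π p ∧ π p₂ = π p ∧ η ≤ |s p₁ - s p₂|}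
    have hD : IsCompact D := by
      have h1 : IsCompact (((π ⁻¹' A) ×ˢ (π ⁻¹' A) ×ˢ (π ⁻¹' A)) ∩
          {z | π z.2.1 = π z.1 ∧ π z.2.2 = π z.1 ∧ η ≤ |s z.2.1 - s z.2.2|}) :=
        (hA.prod (hA.prod hA)).inter_right ((isClosed_eq (by fun_prop) (by fun_prop)).and
          ((isClosed_eq (by fun_prop) (by fun_prop)).and
          (isClosed_le (by fun_prop) (by fun_prop))))
      convert h1.image continuous_fst using 1
      ext p
      constructor
      · rintro ⟨hp, p₁, p₂, h2, h3, h4⟩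
        refine ⟨(p, p₁, p₂), ⟨⟨hp, ?_, ?_⟩, h2, h3, h4⟩, rfl⟩
        · simpa [h2] using hp
        · simpa [h3] using hp
      · rintro ⟨⟨p, p₁, p₂⟩, ⟨⟨hp, -, -⟩, h2, h3, h4⟩, rfl⟩
        exact ⟨hp, p₁, p₂, h2, h3, h4⟩
    have hDA : ∀ p ∈ D, π p ∉ A' := by
      rintro p ⟨hp, p₁, p₂, h2, h3, h4⟩ hpA
      rw [hsc p₁ p₂ (h2.trans h3.symm) (h2 ▸ hpA), sub_self, abs_zero] at h4
      linarith
    obtain ⟨φ, hφ, hφm, hφo, hφW, hφD, hφc⟩ := exists_expansion hM hW hWm hWo τ (η / 2) hτ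
      (half_pos hη) D hD (by
        rintro ⟨x, y⟩ hp t ht
        rcases (hWe _ _ _).1 ht with h | h
        · exact h
        · exact absurd (h.1 ▸ h.2) (hDA _ hp))
    have hφb : ∀ p, π p ∈ A → |φ p| ≤ M := by
      rintro ⟨x, y⟩ hp
      have h2 := abs_le.1 (hbox _ hp).2
      simp only at h2
      have h3 := hφm x h2.1
      have h4 := hφm x h2.2
      simp only at h3 h4
      rw [hφo (x, M) (Or.inr (le_abs_self M))] at h4
      rw [hφo (x, -M) (Or.inr (by simp [le_abs_self]))] at h3
      exact abs_le.2 ⟨h3, h4⟩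
    refine ⟨fun p => s p + φ p, hs.add hφ, fun x => (hsm x).add (hφm x), ?_, ?_, ?_, ?_, ?_⟩
    · intro p hp
      simp only
      rw [hso p hp, hφo p hp]
      push_cast
      ring
    · rintro ⟨x, y⟩ ⟨x', y'⟩ he hpA
      have h1 : x = x' := hfst _ _ he hpA
      subst h1
      simp only
      rw [hsc _ _ he hpA, hφc x y y' ((hWe _ _ _).2 (Or.inr ⟨he, hpA⟩))]
    · intro p p' he hpA
      have key : |s p - s p'| + |φ p - φ p'| ≤ 2 * η * (m + 1) + 2 * M := by
        by_cases hpD : p ∈ D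
        · have hpD' : p' ∈ D := by
            obtain ⟨hp, p₁, p₂, h2, h3, h4⟩ := hpD
            exact ⟨he ▸ hp, p₁, p₂, h2.trans he, h3.trans he, h4⟩
          have h1 := abs_le.1 (hφD p hpD)
          have h2 := abs_le.1 (hφD p' hpD')
          have h3 := abs_le.1 (hsmall p p' he hpA (hDA p hpD))
          have h4 := hosc p p' he hpA
          have h5 : |φ p - φ p'| ≤ 2 * η := abs_le.2 ⟨by linarith, by linarith⟩
          linarith
        · have h1 : |s p - s p'| < η := by
            by_contra! hcon
            exact hpD ⟨hpA, p, p', rfl, he.symm, hcon⟩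
          have h2 := abs_le.1 (hφb p hpA)
          have h3 := abs_le.1 (hφb p' (he ▸ hpA))
          have h5 : |φ p - φ p'| ≤ 2 * M := abs_le.2 ⟨by linarith, by linarith⟩
          have h6 : 0 ≤ η * m := by positivity
          linarith
      push_cast
      refine le_trans ?_ key
      have : s p + φ p - (s p' + φ p') = (s p - s p') + (φ p - φ p') := by ring
      rw [this]
      exact abs_add_le _ _
    · intro p t ht
      have h1 := hup p t ht
      have h2 : φ p ≤ t := by
        by_contra! hcon
        have h3 := hWm p.1 hcon.le
        have h4 := abs_le.1 (hφW p)
        simp only at h3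
        linarith
      push_cast
      linarith
    · intro p t ht
      have h1 := hdn p t ht
      have h2 : t ≤ φ p := by
        by_contra! hcon
        have h3 := hWm p.1 hcon.le
        have h4 := abs_le.1 (hφW p)
        simp only at h3
        linarith
      push_cast
      linarith

/-- Vertical homeomorphisms compressing fibres in the vertical direction, given a collapse of all
vertical fibres which are not already small. -/
theorem exists_vertical_compression (π : ℝ × ℝ → Q) (hπ : Continuous π) {A A' : Set Q}
    {M η ε : ℝ} (hM : 1 < M) (hη : 0 < η) (hε : 0 < ε) (hA : IsCompact (π ⁻¹' A))
    (hA' : IsClosed A') (hAA' : A' ⊆ A)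
    (hbox : ∀ p, π p ∈ A → |p.1| ≤ M - 1 ∧ |p.2| ≤ M - 1)
    (hfst : ∀ p p', π p = π p' → π p ∈ A' → p.1 = p'.1)
    (hconv : ∀ q ∈ A', ∀ x, OrdConnected {y | π (x, y) = q})
    (hsmall : ∀ p p', π p = π p' → π p ∈ A → π p ∉ A' → |p.2 - p'.2| ≤ η) :
    ∃ V : ℝ × ℝ ≃ₜ ℝ × ℝ, (∀ p, dist (π (V p)) (π p) < ε) ∧
      ∀ p p', π p = π p' → π p ∈ A → |(V p).2 - (V p').2| ≤ 3 * η := by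
  have hM0 : 0 < M := by linarith
  obtain ⟨W, hW, hWm, hWo, hWe⟩ := exists_vertical_collapse π hπ A' hA' M hM
    (fun p hp => hbox p (hAA' hp)) hconv
  obtain ⟨τ₀, hτ₀, hτ₀'⟩ := exists_pos_le_of_isCompact
    (K := (Icc (-M) M ×ˢ Icc (-M) M ×ˢ Icc (-M) M) ∩
      {z : ℝ × ℝ × ℝ | ε ≤ dist (π (z.1, z.2.1)) (π (z.1, z.2.2))})
    ((isCompact_Icc.prod (isCompact_Icc.prod isCompact_Icc)).inter_right
      (isClosed_le (by fun_prop) (by fun_prop)))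
    (g := fun z => |W (z.1, z.2.1) - W (z.1, z.2.2)|) (by fun_prop) (by
      rintro ⟨u, t, v⟩ ⟨-, h⟩
      simp only [mem_ofPred_eq] at h ⊢
      rw [abs_pos, sub_ne_zero]
      intro he
      rcases (hWe _ _ _).1 he with h1 | h1
      · rw [h1, dist_self] at h
        linarith
      · rw [h1.1, dist_self] at h
        linarith)
  have hτ : 0 < τ₀ / 2 := half_pos hτ₀
  obtain ⟨m, hm⟩ := exists_nat_gt (4 * M / η)
  rw [div_lt_iff₀ hη] at hm
  obtain ⟨s, hs, hsm, hso, -, hosc, hup, hdn⟩ := exists_layers π hπ (τ := τ₀ / 2) hM0 hη hτ hA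
    (fun p hp => ⟨by linarith [(hbox p hp).1], by linarith [(hbox p hp).2]⟩)
    hfst hsmall hW hWm hWo hWe m
  have hm1 : (0 : ℝ) < m + 1 := by positivity
  let Φ : ℝ × ℝ → ℝ := fun p => (s p + p.2) / (m + 1)
  have hΦ : Continuous Φ := by fun_prop
  have hΦm : ∀ x, StrictMono fun y => Φ (x, y) := fun x a b hab =>
    (div_lt_div_iff_of_pos_right hm1).2 (add_lt_add_of_le_of_lt (hsm x hab.le) hab)
  have hΦo : ∀ p : ℝ × ℝ, M ≤ |p.1| ∨ M ≤ |p.2| → Φ p = p.2 := by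
    intro p hp
    simp only [Φ]
    rw [hso p hp, div_eq_iff hm1.ne']
    ring
  obtain ⟨V, hV⟩ := exists_vertical_homeomorph Φ hΦ hΦm fun x =>
    surjective_of_bounded_displacement _ (hΦ.comp (by fun_prop)) (2 * M) fun y =>
      abs_sub_le_of_eq_off_box hM0 (fun x => (hΦm x).monotone) hΦo (x, y)
  refine ⟨V, ?_, ?_⟩
  · rintro ⟨x, y⟩
    rw [hV]
    by_cases hxy : M ≤ |x| ∨ M ≤ |y|
    · rw [hΦo (x, y) hxy, dist_self]
      exact hε
    push Not at hxy
    have hx := abs_lt.1 hxy.1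
    have hy := abs_lt.1 hxy.2
    have hΦ1 := (hΦm x).monotone hy.1.le
    have hΦ2 := (hΦm x).monotone hy.2.le
    rw [hΦo (x, M) (Or.inr (le_abs_self M))] at hΦ2
    rw [hΦo (x, -M) (Or.inr (by simp [le_abs_self]))] at hΦ1
    by_contra! hcon
    have h1 := hτ₀' (x, Φ (x, y), y) ⟨⟨⟨hx.1.le, hx.2.le⟩, ⟨hΦ1, hΦ2⟩, ⟨hy.1.le, hy.2.le⟩⟩, hcon⟩
    simp only at h1
    have hdef : (m + 1) * Φ (x, y) = s (x, y) + y := by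
      simp only [Φ]
      rw [mul_div_cancel₀ _ hm1.ne']
    rcases le_abs.1 h1 with h2 | h2
    · have h3 := hup (x, y) (Φ (x, y)) (by simp only; linarith)
      have h4 : Φ (x, y) ≤ y := by linarith
      have := hWm x h4
      simp only at this
      linarith
    · have h3 := hdn (x, y) (Φ (x, y)) (by simp only; linarith)
      have h4 : y ≤ Φ (x, y) := by linarith
      have := hWm x h4
      simp only at this
      linarith
  · intro p p' he hpA
    rw [hV, hV]
    simp only [Φ]
    rw [← sub_div, abs_div, abs_of_pos hm1, div_le_iff₀ hm1]
    have h1 := hosc p p' he hpA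
    have h2 := abs_le.1 (hbox p hpA).2
    have h3 := abs_le.1 (hbox p' (he ▸ hpA)).2
    have h4 := abs_le.1 h1
    rw [abs_le]
    constructor <;> nlinarith

theorem shrinkable_of_graph_fibers [ProperSpace Q] {π : ℝ × ℝ → Q} (hπ : IsProperMap π)
    {A : Set Q} (hA : IsCompact A) (hconn : ∀ q ∈ A, IsPreconnected (π ⁻¹' {q}))
    (hinj : ∀ q ∈ A, InjOn Prod.fst (π ⁻¹' {q})) : Shrinkable π A := by
  intro ε hε
  obtain ⟨ρ, hρ, hρ'⟩ := exists_snd_close_of_fst_close hπ hA hinj hε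
  have hc := hπ.continuous
  have hK : IsCompact (π ⁻¹' A) := hπ.isCompact_preimage hA
  let η := min ρ ε / 4
  have hη : 0 < η := by positivity
  have hηρ : 3 * η ≤ ρ := by
    have := min_le_left ρ ε
    simp only [η]
    linarith [lt_min hρ hε]
  have hηε : 3 * η < ε := by
    have := min_le_right ρ ε
    simp only [η]
    linarith [lt_min hρ hε]
  let A' : Set Q := {q | q ∈ A ∧ ∃ p p', π p = q ∧ π p' = q ∧ p.1 + η ≤ p'.1}
  have hA' : IsClosed A' := by
    have h1 : IsCompact (((π ⁻¹' A) ×ˢ (π ⁻¹' A)) ∩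
        {z | π z.1 = π z.2 ∧ z.1.1 + η ≤ z.2.1}) :=
      (hK.prod hK).inter_right ((isClosed_eq (by fun_prop) (by fun_prop)).and
        (isClosed_le (by fun_prop) (by fun_prop)))
    convert (h1.image (hc.comp continuous_fst)).isClosed using 1
    ext q
    constructor
    · rintro ⟨hq, p, p', h2, h3, h4⟩
      refine ⟨(p, p'), ⟨⟨?_, ?_⟩, h2.trans h3.symm, h4⟩, h2⟩
      · simpa [h2] using hq
      · simpa [h3] using hq
    · rintro ⟨⟨p, p'⟩, ⟨⟨h1, -⟩, h2, h3⟩, rfl⟩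
      exact ⟨h1, p, p', rfl, h2.symm, h3⟩
  obtain ⟨M₀, hM₀⟩ := hK.isBounded.subset_closedBall (0 : ℝ × ℝ)
  have H : WideGraphFamily π A' (max M₀ 1) η :=
    { cont := hc
      closed := hA'
      box := fun p hp => (mem_closedBall_zero_iff.1 (hM₀ (show π p ∈ A from hp.1))).trans
        (le_max_left _ _)
      conn := fun q hq => hconn q hq.1
      inj := fun q hq => hinj q hq.1
      wide := fun q hq => hq.2 }
  obtain ⟨F, hF, hFm, hFs, hFc⟩ := H.exists_straightening hη (by positivity)
  obtain ⟨h₀, hh₀⟩ := exists_vertical_homeomorph F hF hFm hFs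
  let h := h₀.trans (Homeomorph.prodComm ℝ ℝ)
  have hh : ∀ p, h p = (F p, p.1) := fun p => by simp [h, hh₀]
  have hhs : ∀ z, (h.symm z).1 = z.2 := fun z => by
    have := hh (h.symm z)
    rw [h.apply_symm_apply] at this
    exact (congrArg Prod.snd this).symm
  have hKh : IsCompact ((π ∘ h.symm) ⁻¹' A) := by
    rw [preimage_comp]
    exact h.symm.isCompact_preimage.2 hK
  obtain ⟨M₁, hM₁⟩ := hKh.isBounded.subset_closedBall (0 : ℝ × ℝ)
  have hb : ∀ p, (π ∘ h.symm) p ∈ A → |p.1| ≤ max M₁ 1 + 1 - 1 ∧ |p.2| ≤ max M₁ 1 + 1 - 1 := by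
    intro p hp
    have := (mem_closedBall_zero_iff.1 (hM₁ hp)).trans (le_max_left _ 1)
    rw [add_sub_cancel_right]
    exact ⟨(norm_fst_le p).trans this, (norm_snd_le p).trans this⟩
  have hfst : ∀ p p', (π ∘ h.symm) p = (π ∘ h.symm) p' → (π ∘ h.symm) p ∈ A' → p.1 = p'.1 := by
    intro p p' he hp
    have := hFc _ _ he hp
    have e1 := hh (h.symm p)
    have e2 := hh (h.symm p')
    rw [h.apply_symm_apply] at e1 e2
    rw [e1, e2]
    exact this
  obtain ⟨V, hV1, hV2⟩ := exists_vertical_compression (π ∘ h.symm)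
    (hc.comp h.symm.continuous) (A := A) (A' := A') (M := max M₁ 1 + 1) (η := η) (ε := min ε ρ)
    (by linarith [le_max_right M₁ 1]) hη (lt_min hε hρ) hKh hA' (fun q hq => hq.1) hb hfst
    (by
      intro q hq x
      refine ⟨fun y₁ h₁ y₂ h₂ y hy => ?_⟩
      have e₁ : π (h.symm (x, y₁)) = q := h₁
      have e₂ : π (h.symm (x, y₂)) = q := h₂
      obtain ⟨c, hc, hcx⟩ := H.exists_mem_fiber (e₁.trans e₂.symm) (e₁ ▸ hq) (x := y)
        (by rw [hhs]; exact hy.1) (by rw [hhs]; exact hy.2)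
      have e3 := hfst (h c) (x, y₁) (by simpa using hc)
        (by simp only [Function.comp_apply, h.symm_apply_apply, hc, e₁]; exact hq)
      have e4 : h c = (x, y) := Prod.ext e3 (by rw [hh]; exact hcx)
      change π (h.symm (x, y)) = q
      rw [← e4, h.symm_apply_apply, hc, e₁])
    (by
      intro p p' he hp hp'
      rw [← hhs p, ← hhs p']
      by_contra! hcon
      refine hp' ⟨hp, ?_⟩
      rcases lt_abs.1 hcon with h1 | h1
      · exact ⟨h.symm p', h.symm p, he.symm, rfl, by linarith⟩
      · exact ⟨h.symm p, h.symm p', rfl, he.symm, by linarith⟩)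
  have hclose : ∀ p, dist (π ((h.trans (V.trans h.symm)) p)) (π p) < min ε ρ := by
    intro p
    have := hV1 (h p)
    simpa using this
  refine ⟨h.trans (V.trans h.symm), fun p => (hclose p).trans_le (min_le_left _ _), ?_⟩
  intro p p' he hp
  have e1 := hV2 (h p) (h p') (by simpa using he) (by simpa using hp)
  have e2 : |((h.trans (V.trans h.symm)) p).1 - ((h.trans (V.trans h.symm)) p').1| ≤ 3 * η := by
    simpa [hhs] using e1
  rw [Prod.dist_eq, Real.dist_eq, Real.dist_eq]
  refine max_lt (e2.trans_lt hηε) (hρ' (π p) hp _ _ ?_ ?_ (e2.trans hηρ))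
  · exact (hclose p).le.trans (min_le_right _ _)
  · have := (hclose p').le.trans (min_le_right _ _)
    rwa [← he] at this

end GraphShrinking

section Convex

theorem IsCompact.exists_forall_dist_lt {X Y : Type*} [PseudoMetricSpace X] [PseudoMetricSpace Y]
    {K : Set X} (hK : IsCompact K) {f : X → Y} (hf : Continuous f) {ε : ℝ} (hε : 0 < ε) :
    ∃ δ > 0, ∀ a ∈ K, ∀ b, dist a b < δ → dist (f a) (f b) < ε := by
  obtain ⟨δ, hδ, h⟩ := Metric.mem_uniformity_dist.1
    (hK.uniformContinuousAt_of_continuousAt f (fun a _ => hf.continuousAt) (dist_mem_uniformity hε))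
  exact ⟨δ, hδ, fun a ha b hab => h hab ha⟩

theorem Shrinkable.comp_collapse {Q : Type*} [PseudoMetricSpace Q] {π : ℝ × ℝ → Q}
    (hπ : Continuous π) {A : Set Q} (h : Shrinkable π A) {W : ℝ × ℝ → ℝ} {M : ℝ} (hM : 0 < M)
    (hW : Continuous W) (hWm : ∀ x, Monotone fun y => W (x, y))
    (hWo : ∀ p : ℝ × ℝ, M ≤ |p.1| ∨ M ≤ |p.2| → W p = p.2) :
    Shrinkable (fun p => π (p.1, W p)) A := by
  intro ε hε
  let K : Set (ℝ × ℝ) := Icc (-M) M ×ˢ Icc (-M) M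
  have hK : IsCompact K := isCompact_Icc.prod isCompact_Icc
  have hoff : ∀ p : ℝ × ℝ, p ∉ K → M ≤ |p.1| ∨ M ≤ |p.2| := by
    intro p hp
    by_contra! hcon
    exact hp ⟨abs_le.1 hcon.1.le, abs_le.1 hcon.2.le⟩
  have hPK : ∀ p ∈ K, (p.1, W p) ∈ K := by
    rintro ⟨x, y⟩ ⟨hx, hy⟩
    have h1 := hWm x hy.1
    have h2 := hWm x hy.2
    simp only at h1 h2
    rw [hWo (x, M) (Or.inr (le_abs_self M))] at h2
    rw [hWo (x, -M) (Or.inr (by simp [le_abs_self]))] at h1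
    exact ⟨hx, h1, h2⟩
  have near : ∀ {Y : Type _} [PseudoMetricSpace Y] (f : ℝ × ℝ → Y), Continuous f → ∀ r > 0,
      ∃ g : ℝ × ℝ ≃ₜ ℝ × ℝ, (∀ p, dist (f (p.1, W p)) (f (g p)) < r) ∧
        ∀ p : ℝ × ℝ, M ≤ |p.1| ∨ M ≤ |p.2| → g p = p := by
    intro Y _ f hf r hr
    obtain ⟨δ, hδ, hδ'⟩ := IsCompact.exists_forall_dist_lt hK hf hr
    obtain ⟨g, hg, hgo⟩ := exists_homeomorph_dist_lt_collapse hM hW hWm hWo δ hδ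
    refine ⟨g, fun p => ?_, hgo⟩
    by_cases hp : p ∈ K
    · exact hδ' _ (hPK p hp) _ (by rw [dist_comm]; exact hg p)
    · have e : (p.1, W p) = p := by rw [hWo p (hoff p hp)]
      rw [hgo p (hoff p hp), e, dist_self]
      exact hr
  obtain ⟨p₁, hp₁, hp₁o⟩ := near π hπ (ε / 3) (by linarith)
  obtain ⟨δ, hδ, hδ'⟩ := IsCompact.exists_forall_dist_lt hK p₁.symm.continuous hε
  have hunif : ∀ a b, dist a b < min δ ε → dist (p₁.symm a) (p₁.symm b) < ε := by
    intro a b hab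
    by_cases ha : a ∈ K
    · exact hδ' a ha b (hab.trans_le (min_le_left _ _))
    by_cases hb : b ∈ K
    · rw [dist_comm]
      exact hδ' b hb a (by rw [dist_comm]; exact hab.trans_le (min_le_left _ _))
    · rw [p₁.symm_apply_eq.2 (hp₁o a (hoff a ha)).symm,
        p₁.symm_apply_eq.2 (hp₁o b (hoff b hb)).symm]
      exact hab.trans_le (min_le_right _ _)
  have hr : 0 < min δ ε / 3 := by positivity
  obtain ⟨θ, hθ, hθ'⟩ := h (min δ ε / 3) hr
  obtain ⟨p₂, hp₂, -⟩ := near (fun p => (θ p, π p)) (by fun_prop) (min δ ε / 3) hr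
  have hrε : min δ ε / 3 ≤ ε / 3 := by linarith [min_le_right δ ε]
  refine ⟨p₂.trans (θ.trans p₁.symm), fun p => ?_, fun p p' he hp => ?_⟩
  · have h1 := hp₁ (p₁.symm (θ (p₂ p)))
    rw [p₁.apply_symm_apply] at h1
    have h2 := hθ (p₂ p)
    have h3 := (le_max_right _ _).trans_lt (Prod.dist_eq.symm.trans_lt (hp₂ p))
    simp only at h3
    rw [dist_comm] at h3
    have h4 := dist_triangle4 (π ((p₁.symm (θ (p₂ p))).1, W (p₁.symm (θ (p₂ p))))) (π (θ (p₂ p)))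
      (π (p₂ p)) (π (p.1, W p))
    simp only [Homeomorph.trans_apply]
    linarith
  · simp only [Homeomorph.trans_apply]
    apply hunif
    have h1 := hθ' _ _ he hp
    have h2 := (le_max_left _ _).trans_lt (Prod.dist_eq.symm.trans_lt (hp₂ p))
    have h3 := (le_max_left _ _).trans_lt (Prod.dist_eq.symm.trans_lt (hp₂ p'))
    simp only at h2 h3
    rw [dist_comm] at h2
    have h4 := dist_triangle4 (θ (p₂ p)) (θ (p.1, W p)) (θ (p'.1, W p')) (θ (p₂ p'))
    linarith

theorem shrinkable_of_convex_fibers {Q : Type*} [MetricSpace Q] [ProperSpace Q] {π : ℝ × ℝ → Q}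
    (hπ : IsProperMap π) (hconv : ∀ q, Convex ℝ (π ⁻¹' {q})) {A : Set Q} (hA : IsCompact A) :
    Shrinkable π A := by
  have hc := hπ.continuous
  obtain ⟨M₀, hM₀⟩ := (hπ.isCompact_preimage hA).isBounded.subset_closedBall (0 : ℝ × ℝ)
  let M := max M₀ 1 + 1
  have hM : 1 < M := by linarith [le_max_right M₀ 1]
  have hM0 : 0 < M := by linarith
  obtain ⟨W, hW, hWm, hWo, hWe⟩ := exists_vertical_collapse π hc A hA.isClosed M hM
    (fun p hp => by
      have := (mem_closedBall_zero_iff.1 (hM₀ hp)).trans (le_max_left _ 1)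
      simp only [M, add_sub_cancel_right]
      exact ⟨(norm_fst_le p).trans this, (norm_snd_le p).trans this⟩)
    (fun q _ x => ((hconv q).affine_preimage
      ((AffineMap.const ℝ ℝ x).prod (AffineMap.id ℝ ℝ))).ordConnected)
  let P : ℝ × ℝ → ℝ × ℝ := fun p => (p.1, W p)
  have hP : Continuous P := by fun_prop
  have hPd : ∀ p, dist (P p) p ≤ 2 * M := by
    intro p
    rw [Prod.dist_eq]
    refine max_le (by simpa [P] using hM0.le) ?_
    rw [Real.dist_eq]
    exact abs_sub_le_of_eq_off_box hM0 hWm hWo p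
  have hPs : Function.Surjective P := by
    rintro ⟨x, y⟩
    obtain ⟨t, ht⟩ := surjective_of_bounded_displacement (fun y => W (x, y)) (by fun_prop) (2 * M)
      (fun y => abs_sub_le_of_eq_off_box hM0 hWm hWo (x, y)) y
    exact ⟨(x, t), Prod.ext rfl ht⟩
  have hPp : IsProperMap P := by
    rw [isProperMap_iff_isCompact_preimage]
    refine ⟨hP, fun K hK => ?_⟩
    refine Metric.isCompact_of_isClosed_isBounded (hK.isClosed.preimage hP) ?_
    exact (hK.isBounded.cthickening (δ := 2 * M)).subset fun p hp =>
      mem_cthickening_of_dist_le p (P p) _ _ hp (by rw [dist_comm]; exact hPd p)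
  have hker : ∀ p p', P p = P p' → π p = π p' := by
    rintro ⟨x, y⟩ ⟨x', y'⟩ he
    obtain ⟨h1, h2⟩ := Prod.mk.inj he
    simp only at h1
    subst h1
    rcases (hWe _ _ _).1 h2 with h3 | h3
    · rw [h3]
    · exact h3.1
  let π₁ : ℝ × ℝ → Q := π ∘ Function.surjInv hPs
  have hπ₁ : ∀ p, π₁ (P p) = π p := fun p => hker _ _ (Function.surjInv_eq hPs (P p))
  have hπ₁c : Continuous π₁ := by
    rw [(hPp.isClosedMap.isQuotientMap hP hPs).continuous_iff]
    exact hc.congr fun p => (hπ₁ p).symm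
  have him : ∀ K, π₁ ⁻¹' K = P '' (π ⁻¹' K) := by
    intro K
    ext z
    obtain ⟨p, rfl⟩ := hPs z
    constructor
    · intro hz
      exact ⟨p, by rwa [mem_preimage, hπ₁] at hz, rfl⟩
    · rintro ⟨p', hp', he⟩
      rw [mem_preimage, ← he, hπ₁]
      exact hp'
  have hπ₁p : IsProperMap π₁ := by
    rw [isProperMap_iff_isCompact_preimage]
    exact ⟨hπ₁c, fun K hK => by rw [him]; exact (hπ.isCompact_preimage hK).image hP⟩
  have hsh : Shrinkable π₁ A := by
    refine shrinkable_of_graph_fibers hπ₁p hA (fun q _ => ?_) fun q hq => ?_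
    · rw [him]
      exact (hconv q).isPreconnected.image P hP.continuousOn
    · rw [him]
      rintro _ ⟨⟨x, y⟩, hp, rfl⟩ _ ⟨⟨x', y'⟩, hp', rfl⟩ he
      have he : x = x' := he
      subst he
      have e1 : π (x, y) = q := hp
      have e2 : π (x, y') = q := hp'
      exact Prod.ext rfl ((hWe x y y').2 (Or.inr ⟨e1.trans e2.symm, e1 ▸ hq⟩))
  have := hsh.comp_collapse hπ₁c hM0 hW hWm hWo
  rwa [show (fun p : ℝ × ℝ => π₁ (p.1, W p)) = π from funext hπ₁] at this

end Convex

section Bing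

variable {Q : Type*} [MetricSpace Q]

theorem exists_improved_homeomorph {π : ℝ × ℝ → Q} (hπ : Continuous π)
    (hsh : ∀ A, IsCompact A → Shrinkable π A) [ProperSpace Q] (n : ℕ) (Θ : ℝ × ℝ ≃ₜ ℝ × ℝ)
    {α : ℝ} (hα : 0 < α) :
    ∃ Θ' : ℝ × ℝ ≃ₜ ℝ × ℝ, ∃ α' > 0, α' ≤ α / 2 ∧ (∀ x, dist (π (Θ x)) (π (Θ' x)) ≤ α / 2) ∧
      ∀ x ∈ closedBall (0 : ℝ × ℝ) n, ∀ y ∈ closedBall (0 : ℝ × ℝ) n,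
        dist (π (Θ' x)) (π (Θ' y)) ≤ 2 * α' → dist x y ≤ 1 / (n + 1) := by
  have hn : (0 : ℝ) < 1 / (n + 1) := Nat.one_div_pos_of_nat
  have hB : IsCompact (closedBall (0 : ℝ × ℝ) n) := isCompact_closedBall _ _
  have hC : IsCompact (Θ '' closedBall (0 : ℝ × ℝ) n) := hB.image Θ.continuous
  obtain ⟨δ, hδ, hδ'⟩ := IsCompact.exists_forall_dist_lt hC Θ.symm.continuous hn
  obtain ⟨θ, hθ, hθ'⟩ := hsh (cthickening 1 (π '' (Θ '' closedBall (0 : ℝ × ℝ) n)))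
    (hC.image hπ).cthickening (min δ (min 1 (α / 2))) (by positivity)
  have hclose : ∀ x, dist (π (Θ x)) (π (θ.symm (Θ x))) < min δ (min 1 (α / 2)) := by
    intro x
    simpa using hθ (θ.symm (Θ x))
  obtain ⟨m, hm, hm'⟩ := exists_pos_le_of_isCompact
    (K := (closedBall (0 : ℝ × ℝ) n ×ˢ closedBall (0 : ℝ × ℝ) n) ∩
      {z | 1 / ((n : ℝ) + 1) ≤ dist z.1 z.2})
    ((hB.prod hB).inter_right (isClosed_le (by fun_prop) (by fun_prop)))
    (g := fun z => dist (π (θ.symm (Θ z.1))) (π (θ.symm (Θ z.2)))) (by fun_prop) (by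
      rintro ⟨x, y⟩ ⟨⟨hx, hy⟩, hxy⟩
      simp only [mem_ofPred_eq] at hx hy hxy ⊢
      rw [dist_pos]
      intro he
      have h1 := hθ' _ _ he (mem_cthickening_of_dist_le _ (π (Θ x)) _ _
        (mem_image_of_mem π (mem_image_of_mem Θ hx)) (by
          rw [dist_comm]
          exact ((hclose x).trans_le ((min_le_right _ _).trans (min_le_left _ _))).le))
      rw [θ.apply_symm_apply, θ.apply_symm_apply] at h1
      have h2 := hδ' _ (mem_image_of_mem Θ hx) _ (h1.trans_le (min_le_left _ _))
      rw [Θ.symm_apply_apply, Θ.symm_apply_apply] at h2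
      linarith)
  refine ⟨Θ.trans θ.symm, min (m / 4) (α / 2), by positivity, min_le_right _ _, fun x => ?_,
    fun x hx y hy hxy => ?_⟩
  · exact ((hclose x).trans_le ((min_le_right _ _).trans (min_le_right _ _))).le
  · by_contra! hcon
    have h1 := hm' (x, y) ⟨⟨hx, hy⟩, hcon.le⟩
    have h2 := min_le_left (m / 4) (α / 2)
    simp only [Homeomorph.trans_apply] at h1 hxy
    linarith

/-- **Bing's shrinking criterion** for proper maps on the plane. -/
theorem exists_homeomorph_dist_lt_of_shrinkable [ProperSpace Q] {π : ℝ × ℝ → Q}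
    (hπ : IsProperMap π) (hs : Function.Surjective π) (hsh : ∀ A, IsCompact A → Shrinkable π A)
    {ε : ℝ} (hε : 0 < ε) : ∃ h : ℝ × ℝ ≃ₜ Q, ∀ x, dist (h x) (π x) < ε := by
  have hc := hπ.continuous
  choose! F a ha ha' hF hinj using
    fun (n : ℕ) (Θ : ℝ × ℝ ≃ₜ ℝ × ℝ) (α : ℝ) (hα : 0 < α) =>
      exists_improved_homeomorph hc hsh n Θ hα
  let S : ℕ → (ℝ × ℝ ≃ₜ ℝ × ℝ) × ℝ := fun n =>
    Nat.rec (Homeomorph.refl _, ε / 2) (fun k s => (F k s.1 s.2, a k s.1 s.2)) n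
  have hS : ∀ n, S (n + 1) = (F n (S n).1 (S n).2, a n (S n).1 (S n).2) := fun n => rfl
  have hpos : ∀ n, 0 < (S n).2 := by
    intro n
    induction n with
    | zero => exact half_pos hε
    | succ n ih => rw [hS]; exact ha _ _ _ ih
  have hhalf : ∀ n, (S (n + 1)).2 ≤ (S n).2 / 2 := fun n => by
    rw [hS]; exact ha' _ _ _ (hpos n)
  have hgeom : ∀ n k, (S (n + k)).2 ≤ (S n).2 / 2 ^ k := by
    intro n k
    induction k with
    | zero => simp
    | succ k ih =>
      refine (hhalf (n + k)).trans ?_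
      rw [pow_succ, ← div_div]
      linarith
  let g : ℕ → ℝ × ℝ → Q := fun n x => π ((S n).1 x)
  have hg : ∀ n k x, dist (g (n + k) x) (g (n + (k + 1)) x) ≤ (S n).2 / 2 / 2 ^ k := by
    intro n k x
    have h1 := hF (n + k) (S (n + k)).1 (S (n + k)).2 (hpos _) x
    refine h1.trans ?_
    rw [div_right_comm]
    linarith [hgeom n k]
  have hlim : ∀ x, ∃ q, Tendsto (fun n => g n x) atTop (𝓝 q) := fun x =>
    cauchySeq_tendsto_of_complete (cauchySeq_of_le_geometric_two fun k => by
      simpa using hg 0 k x)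
  choose f hf using hlim
  have hfg : ∀ n x, dist (g n x) (f x) ≤ (S n).2 := by
    intro n x
    refine dist_le_of_le_geometric_two_of_tendsto₀ (f := fun k => g (n + k) x) (fun k => hg n k x) ?_
    have := (tendsto_add_atTop_iff_nat n).2 (hf x)
    simpa [add_comm] using this
  have hS0 : Tendsto (fun n => (S n).2) atTop (𝓝 0) := by
    have h1 : Tendsto (fun n => (S 0).2 / (2 : ℝ) ^ n) atTop (𝓝 0) :=
      tendsto_const_nhds.div_atTop (tendsto_pow_atTop_atTop_of_one_lt one_lt_two)
    exact squeeze_zero (fun n => (hpos n).le) (fun n => by simpa using hgeom 0 n) h1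
  have hfc : Continuous f := by
    refine TendstoUniformly.continuous (F := g) (p := atTop) ?_ (Frequently.of_forall fun n =>
      hc.comp (S n).1.continuous)
    rw [Metric.tendstoUniformly_iff]
    intro r hr
    filter_upwards [hS0.eventually (gt_mem_nhds hr)] with n hn x
    rw [dist_comm]
    exact (hfg n x).trans_lt hn
  have hfπ : ∀ x, dist (π x) (f x) ≤ ε / 2 := fun x => hfg 0 x
  have hfp : IsProperMap f := by
    rw [isProperMap_iff_isCompact_preimage]
    refine ⟨hfc, fun K hK => ?_⟩
    refine (hπ.isCompact_preimage (hK.cthickening (r := ε / 2))).of_isClosed_subset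
      (hK.isClosed.preimage hfc) fun x hx => ?_
    exact mem_cthickening_of_dist_le _ (f x) _ _ hx (hfπ x)
  have hfi : Function.Injective f := by
    intro x y hxy
    refine dist_le_zero.1 (ge_of_tendsto tendsto_one_div_add_atTop_nhds_zero_nat ?_)
    obtain ⟨N, hN⟩ := exists_nat_ge (max ‖x‖ ‖y‖)
    filter_upwards [eventually_ge_atTop N] with n hn
    have hn' : (N : ℝ) ≤ n := Nat.cast_le.2 hn
    refine hinj n (S n).1 (S n).2 (hpos n) x ?_ y ?_ ?_
    · exact mem_closedBall_zero_iff.2 ((le_max_left _ _).trans (hN.trans hn'))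
    · exact mem_closedBall_zero_iff.2 ((le_max_right _ _).trans (hN.trans hn'))
    · have h1 := hfg (n + 1) x
      have h2 := hfg (n + 1) y
      rw [hxy] at h1
      have h3 := dist_triangle_right (g (n + 1) x) (g (n + 1) y) (f y)
      change dist (g (n + 1) x) (g (n + 1) y) ≤ 2 * (S (n + 1)).2
      linarith
  have hfs : Function.Surjective f := by
    intro q
    have : q ∈ closure (range f) := by
      rw [Metric.mem_closure_iff]
      intro r hr
      obtain ⟨n, hn⟩ := (hS0.eventually (gt_mem_nhds hr)).exists
      obtain ⟨y, rfl⟩ := hs q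
      refine ⟨f ((S n).1.symm y), mem_range_self _, ?_⟩
      have := hfg n ((S n).1.symm y)
      simp only [g, Homeomorph.apply_symm_apply] at this
      exact this.trans_lt hn
    rwa [hfp.isClosedMap.isClosed_range.closure_eq] at this
  refine ⟨(Equiv.ofBijective f ⟨hfi, hfs⟩).toHomeomorphOfContinuousClosed hfc hfp.isClosedMap,
    fun x => ?_⟩
  rw [dist_comm]
  exact (hfπ x).trans_lt (half_lt_self hε)

end Bing

section Moore

variable {Q : Type*} [MetricSpace Q]

theorem exists_continuous_norm_le {E : Type*} [SeminormedAddCommGroup E] {π : E → Q}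
    (hπ : IsProperMap π) : ∃ ψ : Q → ℝ, Continuous ψ ∧ ∀ x, ‖x‖ ≤ ψ (π x) := by
  obtain ⟨ψ, hψ⟩ := exists_continuous_forall_mem_convex_of_local_const
    (t := fun q => {r : ℝ | ∀ x, π x = q → ‖x‖ ≤ r})
    (fun q => by
      have : {r : ℝ | ∀ x, π x = q → ‖x‖ ≤ r} = ⋂ x, ⋂ _ : π x = q, Ici ‖x‖ := by
        ext
        simp
      rw [this]
      exact convex_iInter₂ fun x _ => convex_Ici ‖x‖)
    (fun q => by
      obtain ⟨R, hR⟩ := (hπ.isCompact_preimage (isCompact_singleton (x := q))).isBounded.subset_ball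
        (0 : E)
      have hcl : IsClosed (π '' (ball 0 R)ᶜ) := hπ.isClosedMap _ isOpen_ball.isClosed_compl
      have hq : q ∈ (π '' (ball 0 R)ᶜ)ᶜ := by
        rintro ⟨x, hx, rfl⟩
        exact hx (hR rfl)
      refine ⟨R, ?_⟩
      filter_upwards [hcl.isOpen_compl.mem_nhds hq] with y hy x hx
      by_contra! hcon
      refine hy ⟨x, fun hx' => ?_, hx⟩
      rw [mem_ball_zero_iff] at hx'
      linarith)
  exact ⟨ψ, ψ.continuous, fun x => hψ (π x) x rfl⟩

theorem exists_homeomorph_dist_lt_of_convex_fibers {π : ℝ × ℝ → Q} (hπ : IsProperMap π)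
    (hs : Function.Surjective π) (hconv : ∀ q, Convex ℝ (π ⁻¹' {q})) {ε : ℝ} (hε : 0 < ε) :
    ∃ h : ℝ × ℝ ≃ₜ Q, ∀ x, dist (h x) (π x) < ε := by
  obtain ⟨ψ, hψ, hψπ⟩ := exists_continuous_norm_le hπ
  let e : Q → Q × ℝ := fun q => (q, ψ q)
  have he : IsEmbedding e := .of_comp (by fun_prop) continuous_fst IsEmbedding.id
  let u : Q ≃ₜ range e := he.toHomeomorph
  have hπu : IsProperMap (u ∘ π) := u.isProperMap.comp hπ
  have hus : Function.Surjective (u ∘ π) := u.surjective.comp hs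
  have : ProperSpace (range e) := by
    refine ⟨fun z r => ?_⟩
    refine ((isCompact_closedBall (0 : ℝ × ℝ) (z.1.2 + r)).image hπu.continuous).of_isClosed_subset
      isClosed_closedBall fun w hw => ?_
    obtain ⟨x, rfl⟩ := hus w
    refine ⟨x, ?_, rfl⟩
    have h1 : dist (e (π x)) z.1 ≤ r := hw
    have h2 := (le_max_right _ _).trans (Prod.dist_eq.symm.trans_le h1)
    rw [Real.dist_eq] at h2
    rw [mem_closedBall_zero_iff]
    linarith [hψπ x, (abs_le.1 h2).2]
  obtain ⟨h, hh⟩ := exists_homeomorph_dist_lt_of_shrinkable hπu hus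
    (fun A hA => shrinkable_of_convex_fibers hπu (fun z => by
      obtain ⟨q, rfl⟩ := u.surjective z
      have : u ∘ π ⁻¹' {u q} = π ⁻¹' {q} := by
        ext
        simp
      rw [this]
      exact hconv q) hA) hε
  refine ⟨h.trans u.symm, fun x => ?_⟩
  have h1 : dist (e (u.symm (h x))) (e (π x)) < ε := by
    have : e (u.symm (h x)) = (h x).1 := congrArg Subtype.val (u.apply_symm_apply (h x))
    rw [this]
    exact hh x
  exact (le_max_left _ _).trans_lt (Prod.dist_eq.symm.trans_lt h1)

end Moore

end MoorePlane

/-- Moore's theorem, near-homeomorphism form: Let `G` be an upper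
semicontinuous decomposition of `ℝ²` into compact convex sets with quotient map `π`, and let
`d` be any metric on `ℝ²/G` inducing the quotient topology. Then for every compact `K ⊆ ℝ²`
and every `ε > 0` there is a homeomorphism `h : ℝ² → ℝ²/G` with `d(h x, π x) < ε` on `K`. -/
theorem convex_decomposition_plane_quotient_near_homeomorphism
    (S : Setoid (EuclideanSpace ℝ (Fin 2)))
    (hcompact : ∀ x, IsCompact {y | S x y})
    (hconvex : ∀ x, Convex ℝ {y | S x y})
    (hproper : IsProperMap (Quotient.mk S))
    (m : MetricSpace (Quotient S))
    (hm : m.toUniformSpace.toTopologicalSpace =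
      (instTopologicalSpaceQuotient : TopologicalSpace (Quotient S))) :
    ∀ K : Set (EuclideanSpace ℝ (Fin 2)), IsCompact K → ∀ ε > (0 : ℝ),
      ∃ h : EuclideanSpace ℝ (Fin 2) ≃ₜ Quotient S,
        ∀ x ∈ K, m.dist (h x) (Quotient.mk S x) < ε := by
  intro K _ ε hε
  let m' : MetricSpace (Quotient S) := m.replaceTopology hm.symm
  let L : EuclideanSpace ℝ (Fin 2) ≃L[ℝ] ℝ × ℝ := ContinuousLinearEquiv.ofFinrankEq (by simp)
  obtain ⟨h, hh⟩ := MoorePlane.exists_homeomorph_dist_lt_of_convex_fibers (Q := Quotient S)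
    (π := Quotient.mk S ∘ L.symm) (hproper.comp L.symm.toHomeomorph.isProperMap)
    (Quotient.mk_surjective.comp L.symm.surjective) (fun q => by
      induction q using Quotient.inductionOn with
      | h x =>
        have : Quotient.mk S ∘ L.symm ⁻¹' {Quotient.mk S x} = L.symm ⁻¹' {y | S x y} := by
          ext z
          exact Quotient.eq.trans ⟨S.symm, S.symm⟩
        rw [this]
        exact (hconvex x).linear_preimage L.symm.toLinearEquiv.toLinearMap) hε
  refine ⟨L.toHomeomorph.trans h, fun x _ => ?_⟩
  have := hh (L x)
  simp only [Function.comp_apply, L.symm_apply_apply] at this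
  exact this
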